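/- arXiv:math/0110040 — 8 statements merged into one kernel-verified Lean document; each statement's English description precedes it below -/
import Mathlib

section
/- Let n ≥ 1, let π be a permutation of length n avoiding the pattern 1-3-2, let j be the position of the entry n, and let π' = (π_1,…,π_{j−1}) and π'' = (π_{j+1},…,π_n). Then for every k ≥ 3, e_k(π) = e_k(π') + e_{k−1}(π') + e_k(π''). -/
/-- An occurrence of the classical pattern 1-3-2 in a sequence `w` of distinct
integers is a triple of indices `i < j < k` with `w i < w k < w j`;
`w` avoids 1-3-2 if it has no such occurrence. -/
def Avoids132 {m : ℕ} (w : Fin m → ℤ) : Prop :=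
  ∀ i j k : Fin m, i < j → j < k → ¬(w i < w k ∧ w k < w j)

/-- `π : Fin n → ℤ` is a permutation of length `n`, i.e. a sequence containing
each of the integers `1,…,n` exactly once. -/
def IsPermSeq (n : ℕ) (π : Fin n → ℤ) : Prop :=
  Function.Injective π ∧ ∀ i, 1 ≤ π i ∧ π i ≤ (n : ℤ)

/-- The prefix `π' = (π_1, …, π_{j-1})` of `π` strictly before position `j`. -/
def leftPart {n : ℕ} (π : Fin n → ℤ) (j : Fin n) : Fin (j : ℕ) → ℤ :=
  fun a => π ⟨(a : ℕ), lt_trans a.isLt j.isLt⟩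

/-- The suffix `π'' = (π_{j+1}, …, π_n)` of `π` strictly after position `j`. -/
def rightPart {n : ℕ} (π : Fin n → ℤ) (j : Fin n) : Fin (n - (j : ℕ) - 1) → ℤ :=
  fun a => π ⟨(j : ℕ) + 1 + (a : ℕ), by have h1 := a.isLt; have h2 := j.isLt; omega⟩

/-- An occurrence of the generalized pattern `12-3-…-k` in `w`:
indices `i 0 < i 1 < ⋯ < i (k-1)` with `i 1 = i 0 + 1` and
`w (i 0) < w (i 1) < ⋯ < w (i (k-1))`. -/
def Occ12 {m : ℕ} (k : ℕ) (w : Fin m → ℤ) (i : Fin k → Fin m) : Prop :=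
  StrictMono i ∧ StrictMono (w ∘ i) ∧
    ∀ a b : Fin k, (a : ℕ) = 0 → (b : ℕ) = 1 → (i b : ℕ) = (i a : ℕ) + 1

/-- The relative order of the letters of the pattern `21-3-…-k`. -/
def fPat (j : ℕ) : ℕ := if j = 0 then 1 else if j = 1 then 0 else j

/-- An occurrence of the generalized pattern `21-3-…-k` in `w`:
indices `i 0 < i 1 < ⋯ < i (k-1)` with `i 1 = i 0 + 1` and
`w (i 1) < w (i 0) < w (i 2) < ⋯ < w (i (k-1))`. -/
def Occ21 {m : ℕ} (k : ℕ) (w : Fin m → ℤ) (i : Fin k → Fin m) : Prop :=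
  StrictMono i ∧ (∀ a b : Fin k, fPat (a : ℕ) < fPat (b : ℕ) ↔ w (i a) < w (i b)) ∧
    ∀ a b : Fin k, (a : ℕ) = 0 → (b : ℕ) = 1 → (i b : ℕ) = (i a : ℕ) + 1

/-- `eStat k w` is the number of occurrences of the generalized pattern
`12-3-…-k` in `w` (for `k = 2` this is the number of ascents). -/
noncomputable def eStat (k : ℕ) {m : ℕ} (w : Fin m → ℤ) : ℕ :=
  Nat.card {i : Fin k → Fin m // Occ12 k w i}

/-- `fStat k w` is the number of occurrences of the generalized pattern
`21-3-…-k` in `w` (for `k = 2` this is the number of descents). -/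
noncomputable def fStat (k : ℕ) {m : ℕ} (w : Fin m → ℤ) : ℕ :=
  Nat.card {i : Fin k → Fin m // Occ21 k w i}

/-- The number of ascents of `w`: indices `i` with `w i < w (i+1)`. -/
noncomputable def asc {m : ℕ} (w : Fin m → ℤ) : ℕ :=
  Nat.card {p : Fin m × Fin m // (p.2 : ℕ) = (p.1 : ℕ) + 1 ∧ w p.1 < w p.2}

/-- The number of descents of `w`: indices `i` with `w i > w (i+1)`. -/
noncomputable def des {m : ℕ} (w : Fin m → ℤ) : ℕ :=
  Nat.card {p : Fin m × Fin m // (p.2 : ℕ) = (p.1 : ℕ) + 1 ∧ w p.2 < w p.1}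

/-- `totE w = Σ_{k ≥ 2} e_k(w)`: the total number of 2-increasing
subsequences of `w`. -/
noncomputable def totE {m : ℕ} (w : Fin m → ℤ) : ℕ :=
  Nat.card ((k : ℕ) × {i : Fin k → Fin m // 2 ≤ k ∧ Occ12 k w i})

/-- `totF w = Σ_{k ≥ 2} f_k(w)`: the total number of almost 2-increasing
subsequences of `w`. -/
noncomputable def totF {m : ℕ} (w : Fin m → ℤ) : ℕ :=
  Nat.card ((k : ℕ) × {i : Fin k → Fin m // 2 ≤ k ∧ Occ21 k w i})

theorem occ12_comp_iff {m n : ℕ} (k : ℕ) (w : Fin n → ℤ) (φ : Fin m → Fin n) (c : ℕ)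
    (hφ : ∀ a, (φ a : ℕ) = c + a) (i : Fin k → Fin m) :
    Occ12 k w (φ ∘ i) ↔ Occ12 k (w ∘ φ) i := by
  simp only [Occ12, StrictMono, Function.comp_apply, Fin.lt_def, hφ, Nat.add_lt_add_iff_left,
    Nat.add_assoc, Nat.add_left_cancel_iff]

theorem strictMono_snoc_iff {α : Type*} [Preorder α] {k : ℕ} (f : Fin k → α) (x : α) :
    StrictMono (Fin.snoc f x : Fin (k + 1) → α) ↔ StrictMono f ∧ ∀ a, f a < x := by
  constructor
  · intro h
    refine ⟨fun a b hab => ?_, fun a => ?_⟩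
    · simpa using h (Fin.castSucc_lt_castSucc_iff.2 hab)
    · simpa using h (Fin.castSucc_lt_last a)
  · rintro ⟨h, hx⟩ a b hab
    induction b using Fin.lastCases with
    | last =>
      induction a using Fin.lastCases with
      | last => exact absurd hab (lt_irrefl _)
      | cast a => simpa using hx a
    | cast b =>
      induction a using Fin.lastCases with
      | last => exact absurd hab (not_lt.2 (Fin.le_last _))
      | cast a => simpa using h (Fin.castSucc_lt_castSucc_iff.1 hab)

theorem occ12_snoc_iff {n k : ℕ} (hk : 2 ≤ k) (w : Fin n → ℤ) (f : Fin k → Fin n) (x : Fin n) :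
    Occ12 (k + 1) w (Fin.snoc f x) ↔ Occ12 k w f ∧ ∀ a, f a < x ∧ w (f a) < w x := by
  have hadj : (∀ a b : Fin (k + 1), (a : ℕ) = 0 → (b : ℕ) = 1 →
      ((Fin.snoc f x : Fin (k + 1) → Fin n) b : ℕ) =
        ((Fin.snoc f x : Fin (k + 1) → Fin n) a : ℕ) + 1) ↔
      ∀ a b : Fin k, (a : ℕ) = 0 → (b : ℕ) = 1 → (f b : ℕ) = (f a : ℕ) + 1 := by
    constructor
    · intro h a b ha hb
      simpa using h a.castSucc b.castSucc ha hb
    · intro h a b ha hb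
      obtain ⟨a, rfl⟩ : ∃ a' : Fin k, a'.castSucc = a := ⟨⟨a, by omega⟩, rfl⟩
      obtain ⟨b, rfl⟩ : ∃ b' : Fin k, b'.castSucc = b := ⟨⟨b, by omega⟩, rfl⟩
      simpa using h a b ha hb
  simp only [Occ12, Fin.comp_snoc, strictMono_snoc_iff, hadj, Function.comp_apply, forall_and]
  tauto

/-- In a permutation avoiding 1-3-2, every entry before the maximum exceeds every entry after
it. -/
theorem Avoids132.lt_of_lt_max {n : ℕ} {π : Fin n → ℤ} (hperm : IsPermSeq n π)
    (havoid : Avoids132 π) {a j c : Fin n} (hj : π j = (n : ℤ)) (haj : a ≤ j) (hjc : j < c) :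
    π c < π a := by
  have hc : π c < π j :=
    lt_of_le_of_ne (hj ▸ (hperm.2 c).2) (fun h => hjc.ne' (hperm.1 h))
  rcases haj.eq_or_lt with rfl | haj
  · exact hc
  · have hne : π a ≠ π c := fun h => (haj.trans hjc).ne (hperm.1 h)
    exact lt_of_le_of_ne (not_lt.1 fun h => havoid a j c haj hjc ⟨h, hc⟩) hne.symm

/-- If `π ∈ S_n(1-3-2)` has its maximal entry at position `j`,
then for all `k ≥ 3`, `e_k(π) = e_k(π') + e_{k-1}(π') + e_k(π'')`. -/
theorem eStat_decomposition (n : ℕ) (hn : 1 ≤ n) (π : Fin n → ℤ)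
    (hperm : IsPermSeq n π) (havoid : Avoids132 π)
    (j : Fin n) (hj : π j = (n : ℤ)) (k : ℕ) (hk : 3 ≤ k) :
    eStat k π =
      eStat k (leftPart π j) + eStat (k - 1) (leftPart π j) +
        eStat k (rightPart π j) := by
  obtain ⟨k, rfl⟩ : ∃ m, k = m + 1 := ⟨k - 1, by omega⟩
  rw [Nat.add_sub_cancel]
  have hk2 : 2 ≤ k := by omega
  let φ : Fin (j : ℕ) → Fin n := fun a => ⟨a, a.isLt.trans j.isLt⟩
  let ψ : Fin (n - (j : ℕ) - 1) → Fin n := fun a => ⟨j + 1 + a, by omega⟩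
  have hφ : ∀ (m : ℕ) (i : Fin m → Fin j), Occ12 m π (φ ∘ i) ↔ Occ12 m (leftPart π j) i :=
    fun m => occ12_comp_iff m π φ 0 (fun a => (Nat.zero_add _).symm)
  have hψ : ∀ (m : ℕ) (i : Fin m → Fin (n - j - 1)),
      Occ12 m π (ψ ∘ i) ↔ Occ12 m (rightPart π j) i :=
    fun m => occ12_comp_iff m π ψ (j + 1) (fun a => rfl)
  have hφinj : Function.Injective φ := fun a b h => Fin.ext (Fin.mk.inj h)
  have hψinj : Function.Injective ψ := fun a b h => by
    have := congrArg Fin.val h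
    simp only [ψ] at this
    omega
  have hφlt : ∀ a, φ a < j := fun a => a.isLt
  have hψlt : ∀ a, j < ψ a := fun a => by
    simp only [ψ, Fin.lt_def]
    omega
  have hmax : ∀ a, a ≠ j → π a < π j := fun a ha =>
    lt_of_le_of_ne (hj ▸ (hperm.2 a).2) (fun h => ha (hperm.1 h))
  have liftL : ∀ (m : ℕ) (i : Fin m → Fin n), (∀ a, i a < j) → ∃ i', φ ∘ i' = i :=
    fun m i h => ⟨fun a => ⟨i a, h a⟩, rfl⟩
  let F : ({i // Occ12 (k + 1) (leftPart π j) i} ⊕ {i // Occ12 k (leftPart π j) i}) ⊕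
      {i // Occ12 (k + 1) (rightPart π j) i} → {i // Occ12 (k + 1) π i} :=
    Sum.elim
      (Sum.elim (fun i => ⟨φ ∘ i.1, (hφ _ _).2 i.2⟩)
        (fun i => ⟨Fin.snoc (φ ∘ i.1) j, (occ12_snoc_iff hk2 _ _ _).2
          ⟨(hφ _ _).2 i.2, fun a => ⟨hφlt _, hmax _ (hφlt _).ne⟩⟩⟩))
      (fun i => ⟨ψ ∘ i.1, (hψ _ _).2 i.2⟩)
  have hF : Function.Bijective F := by
    constructor
    · have key : ∀ x y, F x = F y → ∀ a, (F x).1 a = (F y).1 a := fun x y h a => by rw [h]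
      rintro ((x | x) | x) ((y | y) | y) h
      all_goals
        have hl := key _ _ h (Fin.last k)
        have h' := congrArg Subtype.val h
        simp only [F, Sum.elim_inl, Sum.elim_inr, Function.comp_apply, Fin.snoc_last] at hl h'
      · rw [Subtype.ext (hφinj.comp_left h')]
      · exact absurd hl (hφlt _).ne
      · exact absurd hl ((hφlt _).trans (hψlt _)).ne
      · exact absurd hl (hφlt _).ne'
      · rw [Subtype.ext (hφinj.comp_left (Fin.snoc_injective2 h').1)]
      · exact absurd hl (hψlt _).ne
      · exact absurd hl ((hφlt _).trans (hψlt _)).ne'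
      · exact absurd hl (hψlt _).ne'
      · rw [Subtype.ext (hψinj.comp_left h')]
    · rintro ⟨i, hi⟩
      rcases lt_trichotomy (i (Fin.last k)) j with hl | hl | hl
      · obtain ⟨i', rfl⟩ := liftL _ i fun a => (hi.1.monotone (Fin.le_last a)).trans_lt hl
        exact ⟨.inl (.inl ⟨i', (hφ _ _).1 hi⟩), rfl⟩
      · rw [← Fin.snoc_init_self i, hl, occ12_snoc_iff hk2] at hi
        obtain ⟨i', hi'⟩ := liftL _ (Fin.init i) fun a => (hi.2 a).1
        refine ⟨.inl (.inr ⟨i', (hφ _ _).1 (hi' ▸ hi.1)⟩), Subtype.ext ?_⟩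
        simp only [F, Sum.elim_inl, Sum.elim_inr, hi']
        rw [← hl, Fin.snoc_init_self]
      · have h0 : ∀ a, j < i a := by
          intro a
          by_contra! ha
          exact (havoid.lt_of_lt_max hperm hj ha hl).not_ge (hi.2.1.monotone (Fin.le_last a))
        obtain ⟨i', rfl⟩ : ∃ i', ψ ∘ i' = i :=
          ⟨fun a => ⟨i a - j - 1, by have := h0 a; omega⟩, by
            funext a
            have := h0 a
            apply Fin.ext
            simp only [ψ, Function.comp_apply]
            omega⟩
        exact ⟨.inr ⟨i', (hψ _ _).1 hi⟩, rfl⟩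
  simp only [eStat]
  rw [← Nat.card_congr (Equiv.ofBijective F hF), Nat.card_sum, Nat.card_sum]
end

section
/- Let n ≥ 1, let π be a permutation of length n avoiding the pattern 1-3-2, let j be the position of the entry n, and let π' = (π_1,…,π_{j−1}) and π'' = (π_{j+1},…,π_n). Then e_2(π) = e_2(π') + e_2(π'') + δ, where δ = 1 if π' is nonempty and δ = 0 if π' is empty. -/
/-- If `v : ℕ → ℤ` extends `w`, then `eStat 2 w` counts the ascents of `v` below the length
of `w`. -/
theorem eStat_two_eq_sum {m : ℕ} (w : Fin m → ℤ) (v : ℕ → ℤ) (hv : ∀ i : Fin m, w i = v i) :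
    eStat 2 w = ∑ a ∈ Finset.range (m - 1), if v a < v (a + 1) then 1 else 0 := by
  rw [← Finset.card_filter, ← Nat.card_eq_finsetCard, eStat]
  refine Nat.card_eq_of_bijective (fun i => ⟨(i.1 0 : ℕ), ?_⟩) ⟨?_, ?_⟩
  · obtain ⟨i, hi, hw, hs⟩ := i
    have h01 : (i 1 : ℕ) = i 0 + 1 := hs 0 1 rfl rfl
    have hlt : w (i 0) < w (i 1) := hw (by decide)
    have hm : (i 0 : ℕ) < m - 1 := by have := (i 1).isLt; omega
    rw [hv, hv, h01] at hlt
    exact Finset.mem_filter.2 ⟨Finset.mem_range.2 hm, hlt⟩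
  · rintro ⟨i, hi, hw, hs⟩ ⟨i', hi', hw', hs'⟩ h
    have h0 : (i 0 : ℕ) = i' 0 := congrArg Subtype.val h
    have h1 : (i 1 : ℕ) = i 0 + 1 := hs 0 1 rfl rfl
    have h1' : (i' 1 : ℕ) = i' 0 + 1 := hs' 0 1 rfl rfl
    refine Subtype.ext (funext fun a => Fin.ext ?_)
    fin_cases a
    · exact h0
    · exact h1.trans ((congrArg (· + 1) h0).trans h1'.symm)
  · rintro ⟨a, ha⟩
    rw [Finset.mem_filter, Finset.mem_range] at ha
    obtain ⟨ham, hav⟩ := ha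
    refine ⟨⟨![⟨a, by omega⟩, ⟨a + 1, by omega⟩], ?_, ?_, ?_⟩, rfl⟩
    · rw [Fin.strictMono_iff_lt_succ]
      intro b
      fin_cases b
      simp
    · rw [Fin.strictMono_iff_lt_succ]
      intro b
      fin_cases b
      simpa [hv] using hav
    · intro b c hb hc
      obtain rfl : b = 0 := Fin.ext hb
      obtain rfl : c = 1 := Fin.ext hc
      rfl

/-- If `π ∈ S_n(1-3-2)` has its maximal entry at position `j`,
then `e_2(π) = e_2(π') + e_2(π'') + δ`, where `δ = 1` iff `π'` is nonempty. -/
theorem eStat_two_decomposition (n : ℕ) (hn : 1 ≤ n) (π : Fin n → ℤ)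
    (hperm : IsPermSeq n π) (havoid : Avoids132 π)
    (j : Fin n) (hj : π j = (n : ℤ)) :
    eStat 2 π =
      eStat 2 (leftPart π j) + eStat 2 (rightPart π j) +
        (if (j : ℕ) = 0 then 0 else 1) := by
  have hlt : ∀ i, i ≠ j → π i < π j := fun i hi =>
    lt_of_le_of_ne (hj ▸ (hperm.2 i).2) (hperm.1.ne hi)
  obtain ⟨v, hv⟩ : ∃ v : ℕ → ℤ, ∀ i : Fin n, π i = v i :=
    ⟨fun a => if h : a < n then π ⟨a, h⟩ else 0, fun i => by simp⟩
  have hvlt : ∀ a, a < n → a ≠ j → v a < v j := fun a ha hne => by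
    simpa [hv] using hlt ⟨a, ha⟩ (fun h => hne (congrArg Fin.val h))
  rw [eStat_two_eq_sum π v hv, eStat_two_eq_sum (leftPart π j) v (fun i => hv _),
    eStat_two_eq_sum (rightPart π j) (fun a => v (j + 1 + a)) (fun i => hv _)]
  have hjn := j.isLt
  generalize (j : ℕ) = p at hvlt hjn ⊢
  have hleft : ∑ a ∈ Finset.range p, (if v a < v (a + 1) then 1 else 0) =
      ∑ a ∈ Finset.range (p - 1), (if v a < v (a + 1) then 1 else 0) +
        if p = 0 then 0 else 1 := by
    rcases p with _ | p
    · simp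
    · rw [Finset.sum_range_succ, if_pos (hvlt p (by omega) (by omega))]
      rfl
  have hright : ∑ a ∈ Finset.range (n - 1 - p),
        (if v (p + a) < v (p + a + 1) then 1 else 0) =
      ∑ a ∈ Finset.range (n - p - 1 - 1),
        if v (p + 1 + a) < v (p + 1 + (a + 1)) then 1 else 0 := by
    obtain h | ⟨r, h⟩ : n - 1 - p = 0 ∨ ∃ r, n - 1 - p = r + 1 := by
      rcases n - 1 - p with _ | r
      · exact .inl rfl
      · exact .inr ⟨r, rfl⟩
    · rw [h, show n - p - 1 - 1 = 0 by omega]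
      rfl
    · have hdesc := hvlt (p + 1) (by omega) (by omega)
      rw [h, show n - p - 1 - 1 = r by omega, Finset.sum_range_succ']
      simp only [add_zero, hdesc.not_gt, if_false]
      refine Finset.sum_congr rfl fun a _ => ?_
      rw [show p + (a + 1) = p + 1 + a by omega, add_assoc (p + 1)]
  rw [show n - 1 = p + (n - 1 - p) by omega, Finset.sum_range_add, hleft, hright]
  ring
end

section
/- Let n ≥ 1, let π be a permutation of length n avoiding the pattern 1-3-2, let j be the position of the entry n, and let π' = (π_1,…,π_{j−1}) and π'' = (π_{j+1},…,π_n). Then for every k ≥ 3, f_k(π) = f_k(π') + f_{k−1}(π') + f_k(π''). -/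
theorem fPat_of_two_le {a : ℕ} (ha : 2 ≤ a) : fPat a = a := by
  unfold fPat; split_ifs <;> omega

theorem fPat_lt {a m : ℕ} (hm : 2 ≤ m) (ha : a < m) : fPat a < m := by
  unfold fPat; split_ifs <;> omega

/-- Embedding a sequence onto a block of consecutive positions preserves and reflects
occurrences. -/
theorem occ21_comp_iff {m n k c : ℕ} {φ : Fin m → Fin n}
    (hφ : ∀ a, (φ a : ℕ) = c + a) (w : Fin n → ℤ) (i : Fin k → Fin m) :
    Occ21 k w (φ ∘ i) ↔ Occ21 k (w ∘ φ) i := by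
  unfold Occ21 StrictMono
  have hlt : ∀ a b, φ a < φ b ↔ a < b := fun a b => by
    rw [Fin.lt_def, Fin.lt_def, hφ, hφ, add_lt_add_iff_left]
  simp [hlt, hφ, add_assoc]

/-- Occurrences in a block of consecutive positions are the occurrences in the whole sequence
all of whose positions lie in the block. -/
theorem fStat_comp {m n c : ℕ} {φ : Fin m → Fin n}
    (hφ : ∀ a, (φ a : ℕ) = c + a) (k : ℕ) (w : Fin n → ℤ) :
    fStat k (w ∘ φ) = {i | Occ21 k w i ∧ ∀ a, i a ∈ Set.range φ}.ncard := by
  have hinj : Function.Injective φ := fun a b h => by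
    have := congrArg Fin.val h
    rw [hφ, hφ] at this
    exact Fin.ext (by omega)
  have himage : {i | Occ21 k w i ∧ ∀ a, i a ∈ Set.range φ} =
      (fun i => φ ∘ i) '' {i | Occ21 k (w ∘ φ) i} := by
    ext i
    constructor
    · rintro ⟨hi, hr⟩
      choose g hg using hr
      obtain rfl : φ ∘ g = i := funext hg
      exact ⟨g, (occ21_comp_iff hφ w g).1 hi, rfl⟩
    · rintro ⟨g, hg, rfl⟩
      exact ⟨(occ21_comp_iff hφ w g).2 hg, fun a => ⟨g a, rfl⟩⟩
  rw [himage, Set.ncard_image_of_injective _ hinj.comp_left]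
  rfl

theorem fStat_leftPart {n : ℕ} (π : Fin n → ℤ) (j : Fin n) (k : ℕ) :
    fStat k (leftPart π j) = {i | Occ21 k π i ∧ ∀ a, i a < j}.ncard := by
  have hrange : Set.range (Fin.castLE j.isLt.le) = {x | x < j} := by
    ext x
    exact ⟨by rintro ⟨y, rfl⟩; exact y.isLt, fun hx => ⟨⟨x, hx⟩, rfl⟩⟩
  have h := fStat_comp (φ := Fin.castLE j.isLt.le) (c := 0) (by simp) k π
  rw [hrange] at h
  exact h

theorem fStat_rightPart {n : ℕ} (π : Fin n → ℤ) (j : Fin n) (k : ℕ) :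
    fStat k (rightPart π j) = {i | Occ21 k π i ∧ ∀ a, j < i a}.ncard := by
  let φ : Fin (n - (j : ℕ) - 1) → Fin n :=
    fun a => ⟨(j : ℕ) + 1 + (a : ℕ), by have h1 := a.isLt; have h2 := j.isLt; omega⟩
  have hrange : Set.range φ = {x | j < x} := by
    ext x
    constructor
    · rintro ⟨y, rfl⟩
      simp only [Set.mem_ofPred_eq, Fin.lt_def, φ]
      omega
    · intro hx
      simp only [Set.mem_ofPred_eq, Fin.lt_def] at hx
      exact ⟨⟨x - j - 1, by omega⟩, Fin.ext (by simp only [φ]; omega)⟩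
  have h := fStat_comp (φ := φ) (c := j + 1) (fun _ => rfl) k π
  rw [hrange] at h
  exact h

/-- Appending the position of a maximal entry to an occurrence lying to its left. -/
theorem occ21_snoc_iff {n m : ℕ} (hm : 2 ≤ m) {π : Fin n → ℤ} {j : Fin n}
    (hmax : ∀ x, x ≠ j → π x < π j) (i : Fin m → Fin n) :
    Occ21 (m + 1) π (Fin.snoc i j : Fin (m + 1) → Fin n) ↔
      Occ21 m π i ∧ ∀ a, i a < j := by
  constructor
  · rintro ⟨hmono, hpat, hadj⟩
    refine ⟨⟨fun a b hab => ?_, fun a b => ?_, fun a b ha hb => ?_⟩, fun a => ?_⟩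
    · simpa using hmono (Fin.castSucc_lt_castSucc_iff.2 hab)
    · simpa using hpat a.castSucc b.castSucc
    · simpa using hadj a.castSucc b.castSucc ha hb
    · simpa using hmono (Fin.castSucc_lt_last a)
  · rintro ⟨⟨hmono, hpat, hadj⟩, hlt⟩
    have hval : ∀ a, π (i a) < π j := fun a => hmax _ (hlt a).ne
    refine ⟨fun a b => ?_, fun a b => ?_, fun a b => ?_⟩
    · induction a using Fin.lastCases <;> induction b using Fin.lastCases
      · simp
      · exact fun h => absurd h (Fin.le_last _).not_gt
      · simp [hlt]
      · simpa using fun h => hmono h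
    · induction a using Fin.lastCases <;> induction b using Fin.lastCases
      · simp
      · rename_i b
        simp [fPat_of_two_le hm, (hval b).not_gt, (fPat_lt hm b.isLt).not_gt]
      · rename_i a
        simpa [fPat_of_two_le hm, hval a] using fPat_lt hm a.isLt
      · simpa using hpat _ _
    · induction a using Fin.lastCases <;> induction b using Fin.lastCases
      · simp; omega
      · simp; omega
      · simp; omega
      · simpa using hadj _ _

theorem ncard_occ21_last_eq {n m : ℕ} (hm : 2 ≤ m) {π : Fin n → ℤ} {j : Fin n}
    (hmax : ∀ x, x ≠ j → π x < π j) :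
    {i | Occ21 (m + 1) π i ∧ i (Fin.last m) = j}.ncard = fStat m (leftPart π j) := by
  rw [fStat_leftPart]
  have himage : {i | Occ21 (m + 1) π i ∧ i (Fin.last m) = j} =
      (fun i => (Fin.snoc i j : Fin (m + 1) → Fin n)) ''
        {i | Occ21 m π i ∧ ∀ a, i a < j} := by
    ext i
    constructor
    · rintro ⟨hi, hlast⟩
      have hsnoc : (Fin.snoc (Fin.init i) j : Fin (m + 1) → Fin n) = i := by
        rw [← hlast, Fin.snoc_init_self]
      exact ⟨Fin.init i, (occ21_snoc_iff hm hmax _).1 (hsnoc.symm ▸ hi), hsnoc⟩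
    · rintro ⟨g, hg, rfl⟩
      exact ⟨(occ21_snoc_iff hm hmax g).2 hg, by simp⟩
  rw [himage, Set.ncard_image_of_injective]
  intro a b h
  simpa using congrArg Fin.init h

/-- In a 1-3-2-avoiding sequence an occurrence of `21-3-…-k` ending to the right of the maximal
entry lies entirely to its right. -/
theorem Occ21.lt_of_lt_last {n m : ℕ} (hm : 2 ≤ m) {π : Fin n → ℤ} {j : Fin n}
    (hmax : ∀ x, x ≠ j → π x < π j) (havoid : Avoids132 π) {i : Fin (m + 1) → Fin n}
    (hi : Occ21 (m + 1) π i) (hlast : j < i (Fin.last m)) (a : Fin (m + 1)) : j < i a := by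
  obtain ⟨hmono, hpat, -⟩ := hi
  have h0 : π (i 0) < π (i (Fin.last m)) := by
    rw [← hpat, Fin.val_last, fPat_of_two_le hm]
    exact fPat_lt hm (by simp; omega)
  have hj : π (i (Fin.last m)) < π j := hmax _ hlast.ne'
  refine lt_of_lt_of_le ?_ (hmono.monotone (Fin.zero_le a))
  rcases lt_trichotomy (i 0) j with h | h | h
  · exact absurd ⟨h0, hj⟩ (havoid _ _ _ h hlast)
  · rw [h] at h0
    exact absurd h0 hj.not_gt
  · exact h

/-- If `π ∈ S_n(1-3-2)` has its maximal entry at position `j`,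
then for all `k ≥ 3`, `f_k(π) = f_k(π') + f_{k-1}(π') + f_k(π'')`. -/
theorem fStat_decomposition (n : ℕ) (hn : 1 ≤ n) (π : Fin n → ℤ)
    (hperm : IsPermSeq n π) (havoid : Avoids132 π)
    (j : Fin n) (hj : π j = (n : ℤ)) (k : ℕ) (hk : 3 ≤ k) :
    fStat k π =
      fStat k (leftPart π j) + fStat (k - 1) (leftPart π j) +
        fStat k (rightPart π j) := by
  have hmax : ∀ x, x ≠ j → π x < π j := fun x hx =>
    lt_of_le_of_ne (hj ▸ (hperm.2 x).2) fun h => hx (hperm.1 h)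
  obtain ⟨m, rfl⟩ : ∃ m, k = m + 1 := ⟨k - 1, by omega⟩
  have hm : 2 ≤ m := by omega
  rw [Nat.add_sub_cancel, ← ncard_occ21_last_eq hm hmax, fStat_leftPart, fStat_rightPart,
    ← Set.ncard_union_eq, ← Set.ncard_union_eq]
  · change {i | Occ21 (m + 1) π i}.ncard = _
    congr 1
    ext i
    simp only [Set.mem_ofPred_eq, Set.mem_union]
    constructor
    · intro hi
      rcases lt_trichotomy (i (Fin.last m)) j with h | h | h
      · exact .inl (.inl ⟨hi, fun a => (hi.1.monotone (Fin.le_last a)).trans_lt h⟩)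
      · exact .inl (.inr ⟨hi, h⟩)
      · exact .inr ⟨hi, hi.lt_of_lt_last hm hmax havoid h⟩
    · tauto
  · rw [Set.disjoint_left]
    rintro i (⟨-, h⟩ | ⟨-, h⟩) ⟨-, h'⟩
    · exact (h (Fin.last m)).not_gt (h' _)
    · exact (h' (Fin.last m)).ne' h
  · rw [Set.disjoint_left]
    rintro i ⟨-, h⟩ ⟨-, h'⟩
    exact (h (Fin.last m)).ne h'
end

section
/- Let n ≥ 1, let π be a permutation of length n avoiding the pattern 1-3-2, let j be the position of the entry n, and let π' = (π_1,…,π_{j−1}) and π'' = (π_{j+1},…,π_n). Then f_2(π) = f_2(π') + f_2(π'') + δ, where δ = 1 if π'' is nonempty and δ = 0 if π'' is empty. -/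
/-- The number of descents of a sequence given by the first `m` values of `u`. -/
theorem fStat_two_eq_count {m : ℕ} (w : Fin m → ℤ) (u : ℕ → ℤ) (h : ∀ i, w i = u i) :
    fStat 2 w = Nat.count (fun a => u (a + 1) < u a) (m - 1) := by
  rw [Nat.count_eq_card_filter_range, fStat, ← Nat.card_eq_finsetCard]
  refine Nat.card_congr (Equiv.ofBijective
    (fun i => ⟨(i.1 0 : ℕ), ?_⟩) ⟨?_, ?_⟩)
  · obtain ⟨i, -, hpat, hadj⟩ := i
    have h₁ : (i 1 : ℕ) = i 0 + 1 := hadj 0 1 rfl rfl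
    have h₂ := (hpat 1 0).1 (by decide)
    rw [h, h, h₁] at h₂
    have h₃ := (i 1).isLt
    simp only [Finset.mem_filter, Finset.mem_range]
    exact ⟨by omega, h₂⟩
  · rintro ⟨i, hi⟩ ⟨k, hk⟩ hik
    have h₀ : (i 0 : ℕ) = k 0 := congrArg Subtype.val hik
    have hi₁ : (i 1 : ℕ) = i 0 + 1 := hi.2.2 0 1 rfl rfl
    have hk₁ : (k 1 : ℕ) = k 0 + 1 := hk.2.2 0 1 rfl rfl
    ext a
    fin_cases a
    · exact h₀
    · change (i 1 : ℕ) = k 1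
      omega
  · rintro ⟨a, ha⟩
    simp only [Finset.mem_filter, Finset.mem_range] at ha
    refine ⟨⟨![⟨a, by omega⟩, ⟨a + 1, by omega⟩], ?_, ?_, ?_⟩, rfl⟩
    · simp [Fin.strictMono_iff_lt_succ]
    · intro b c
      fin_cases b <;> fin_cases c <;> simp [fPat, h, ha.2, ha.2.le]
    · intro b c hb hc
      obtain rfl : b = 0 := Fin.ext hb
      obtain rfl : c = 1 := Fin.ext hc
      rfl

/-- If `π ∈ S_n(1-3-2)` has its maximal entry at position `j`,
then `f_2(π) = f_2(π') + f_2(π'') + δ`, where `δ = 1` iff `π''` is nonempty. -/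
theorem fStat_two_decomposition (n : ℕ) (hn : 1 ≤ n) (π : Fin n → ℤ)
    (hperm : IsPermSeq n π) (havoid : Avoids132 π)
    (j : Fin n) (hj : π j = (n : ℤ)) :
    fStat 2 π =
      fStat 2 (leftPart π j) + fStat 2 (rightPart π j) +
        (if (j : ℕ) + 1 < n then 1 else 0) := by
  let u : ℕ → ℤ := fun a => if h : a < n then π ⟨a, h⟩ else 0
  have hu (i : Fin n) : π i = u i := by simp [u]
  have hlt (i : Fin n) (hi : i ≠ j) : π i < π j :=
    lt_of_le_of_ne (hj ▸ (hperm.2 i).2) (hperm.1.ne hi)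
  rw [fStat_two_eq_count π u hu,
    fStat_two_eq_count (leftPart π j) u (fun a => hu _),
    fStat_two_eq_count (rightPart π j) (fun a => u (j + 1 + a)) (fun a => hu _)]
  have hjn := j.isLt
  have hprefix : Nat.count (fun a => u (a + 1) < u a) j =
      Nat.count (fun a => u (a + 1) < u a) (j - 1) := by
    rcases Nat.eq_zero_or_pos (j : ℕ) with h₀ | h₀
    · simp [h₀]
    · obtain ⟨k, hk⟩ := Nat.exists_eq_add_of_le' h₀
      have hkn : k < n := by omega
      have hasc := hlt ⟨k, hkn⟩ (by simp [Fin.ext_iff, hk])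
      rw [hu, hu j, hk] at hasc
      rw [hk, Nat.count_succ, if_neg hasc.not_gt]
      rfl
  split_ifs with hne
  · have hdesc := hlt ⟨j + 1, hne⟩ (by simp [Fin.ext_iff])
    rw [hu, hu j] at hdesc
    rw [show n - 1 = j + 1 + (n - j - 1 - 1) by omega, Nat.count_add, Nat.count_succ,
      if_pos hdesc, hprefix]
    simp only [← add_assoc]
    omega
  · rw [show n - 1 = j by omega, show n - j - 1 - 1 = 0 by omega, hprefix]
    simp
end

section
/- For all n ≥ 1 and 0 ≤ k ≤ n−1, the number of permutations of length n that avoid the pattern 1-3-2 and have exactly k ascents equals the Narayana number N(n,k) = (1/n)·binomial(n,k)·binomial(n,k+1). -/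
/-- The Narayana number `N(n,k) = C(n,k) C(n,k+1) / n`. -/
def narayana (n k : ℕ) : ℚ := (n.choose k : ℚ) * (n.choose (k + 1) : ℚ) / n

lemma cast_choose_succ_mul (n k : ℕ) :
    (n.choose (k + 1) : ℚ) * (k + 1) = n.choose k * (n - k) := by
  rcases le_or_gt k n with h | h
  · rw [← Nat.cast_sub h]
    exact_mod_cast Nat.choose_succ_right_eq n k
  · simp [Nat.choose_eq_zero_of_lt h, Nat.choose_eq_zero_of_lt (Nat.lt_succ_of_lt h)]

lemma narayana_recurrence_zero (m : ℕ) :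
    ((m : ℚ) + 4) * narayana (m + 3) 0 =
      (2 * m + 5) * narayana (m + 2) 0 - (m + 1) * narayana (m + 1) 0 := by
  simp only [narayana, zero_add, Nat.choose_zero_right, Nat.choose_one_right]
  push_cast
  field_simp
  ring

lemma narayana_recurrence_one (m : ℕ) :
    ((m : ℚ) + 4) * narayana (m + 3) 1 =
      (2 * m + 5) * (narayana (m + 2) 1 + narayana (m + 2) 0) -
        (m + 1) * (narayana (m + 1) 1 - 2 * narayana (m + 1) 0) := by
  simp only [narayana, zero_add, Nat.reduceAdd, Nat.choose_zero_right, Nat.choose_one_right,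
    Nat.cast_choose_two]
  push_cast
  field_simp
  ring

lemma narayana_recurrence_add_two (m j : ℕ) :
    ((m : ℚ) + 4) * narayana (m + 3) (j + 2) =
      (2 * m + 5) * (narayana (m + 2) (j + 2) + narayana (m + 2) (j + 1)) -
        (m + 1) * (narayana (m + 1) (j + 2) - 2 * narayana (m + 1) (j + 1)
          + narayana (m + 1) j) := by
  have hq := cast_choose_succ_mul (m + 1) j
  have hr := cast_choose_succ_mul (m + 1) (j + 1)
  have hs := cast_choose_succ_mul (m + 1) (j + 2)
  simp only [narayana, add_assoc, Nat.reduceAdd] at hq hr hs ⊢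
  rw [Nat.choose_succ_succ' (m + 2) (j + 1), Nat.choose_succ_succ' (m + 2) (j + 2),
    Nat.choose_succ_succ' (m + 1) j, Nat.choose_succ_succ' (m + 1) (j + 1),
    Nat.choose_succ_succ' (m + 1) (j + 2)]
  push_cast at hq hr hs ⊢
  rw [← eq_div_iff (by positivity)] at hq hr hs
  rw [hs, hr, hq]
  field_simp
  ring

/-- The three-term recurrence obtained from the quadratic equation of the generating function. -/
lemma three_term_recurrence {R : Type*} [CommRing R] [IsDomain R] [CharZero R] {t : R}
    (ht : t ≠ 0) (A : ℕ → R) (h0 : A 0 = 1)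
    (hA : ∀ n, A (n + 1) = ∑ p ∈ Finset.HasAntidiagonal.antidiagonal n,
      (if p.1 = 0 then 1 else t) * A p.1 * A p.2) (m : ℕ) :
    ((m : R) + 4) * A (m + 3) =
      (2 * (m : R) + 5) * ((1 + t) * A (m + 2)) -
        ((m : R) + 1) * ((1 - t) ^ 2 * A (m + 1)) := by
  set T : PowerSeries R := PowerSeries.C t with hT
  set x : PowerSeries R := PowerSeries.X with hx
  set G : PowerSeries R := PowerSeries.mk A with hG
  set E : PowerSeries R := PowerSeries.mk fun n => (if n = 0 then 1 else t) * A n with hE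
  have hEG : E = T * G + (1 - T) := by
    ext n
    rcases n with _ | n
    · simp [hE, hT, hG, h0]
    · simp [hE, hT, hG, PowerSeries.coeff_C_mul, PowerSeries.coeff_one]
  have hquad : G = 1 + x * (E * G) := by
    ext n
    rcases n with _ | n
    · simp [hx, hG, h0]
    · rw [map_add, hx, PowerSeries.coeff_succ_X_mul, PowerSeries.coeff_mul]
      simp [hE, hG, hA, PowerSeries.coeff_one]
  rw [hEG] at hquad
  set S : PowerSeries R := 1 - x + x * T - 2 * x * T * G with hS
  set D : PowerSeries R := 1 - 2 * (1 + T) * x + (1 - T) ^ 2 * x ^ 2 with hD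
  have hSD : S ^ 2 = D := by
    rw [hS, hD]
    linear_combination (-4 * x * T) * hquad
  have hS0 : S ≠ 0 := by
    intro h
    have := congrArg (PowerSeries.constantCoeff) h
    simp [hS, hx] at this
  have hC2 : (2 : PowerSeries R) = PowerSeries.C 2 := (map_ofNat PowerSeries.C 2).symm
  have h20 : (2 : PowerSeries R) ≠ 0 := by
    intro h
    have := congrArg (PowerSeries.constantCoeff) h
    rw [hC2, PowerSeries.constantCoeff_C, map_zero] at this
    exact two_ne_zero this
  have hdx : PowerSeries.derivative R x = 1 := PowerSeries.derivative_X
  have hode : D * PowerSeries.derivative R S = (- (1 + T) + (1 - T) ^ 2 * x) * S := by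
    have hdD : PowerSeries.derivative R D = - 2 * (1 + T) + 2 * (1 - T) ^ 2 * x := by
      have h1t : PowerSeries.derivative R (2 * (1 + T)) = 0 := by
        rw [show 2 * (1 + T) = PowerSeries.C (2 * (1 + t)) by
          rw [hC2, map_mul, map_add, map_one]]
        exact PowerSeries.derivative_C
      have h2t : PowerSeries.derivative R ((1 - T) ^ 2) = 0 := by
        rw [show (1 - T) ^ 2 = PowerSeries.C ((1 - t) ^ 2) by
          rw [map_pow, map_sub, map_one]]
        exact PowerSeries.derivative_C
      rw [hD, map_add, map_sub, Derivation.leibniz, Derivation.leibniz _ _ (x ^ 2),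
        Derivation.leibniz_pow, h1t, h2t, hdx, PowerSeries.derivative_one]
      simp only [smul_eq_mul, nsmul_eq_mul]
      push_cast
      ring
    have h2 := congrArg (PowerSeries.derivative R) hSD
    rw [hdD, Derivation.leibniz_pow] at h2
    simp only [smul_eq_mul, nsmul_eq_mul] at h2
    push_cast at h2
    have h3 : 2 * (D * PowerSeries.derivative R S) =
        2 * ((- (1 + T) + (1 - T) ^ 2 * x) * S) := by
      linear_combination S * h2 - 2 * PowerSeries.derivative R S * hSD
    exact mul_left_cancel₀ h20 h3
  have hcoeff (n : ℕ) : PowerSeries.coeff (n + 2) S = -2 * t * A (n + 1) := by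
    have : S = 1 - x + PowerSeries.C t * x - PowerSeries.C (2 * t) * (x * G) := by
      rw [hS, map_mul, ← hT, ← hC2]; ring
    rw [this, map_sub, PowerSeries.coeff_C_mul, hx, PowerSeries.coeff_succ_X_mul]
    simp [hG, PowerSeries.coeff_one, PowerSeries.coeff_X]
  have hl : D * PowerSeries.derivative R S = PowerSeries.derivative R S
      - PowerSeries.C (2 * (1 + t)) * (x * PowerSeries.derivative R S)
      + PowerSeries.C ((1 - t) ^ 2) * (x * (x * PowerSeries.derivative R S)) := by
    simp only [hD, map_mul, map_add, map_sub, map_pow, map_one, ← hT, ← hC2]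
    ring
  have hr : (- (1 + T) + (1 - T) ^ 2 * x) * S =
      - (PowerSeries.C (1 + t) * S) + PowerSeries.C ((1 - t) ^ 2) * (x * S) := by
    simp only [map_add, map_sub, map_pow, map_one, ← hT]
    ring
  have hfin := congrArg (PowerSeries.coeff (m + 3)) hode
  rw [hl, hr, map_add, map_add, map_sub, map_neg] at hfin
  simp only [PowerSeries.coeff_C_mul, hx,
    PowerSeries.coeff_succ_X_mul, PowerSeries.coeff_derivative, hcoeff] at hfin
  push_cast at hfin
  refine mul_left_cancel₀ (mul_ne_zero two_ne_zero ht) ?_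
  linear_combination -hfin

open Polynomial in
lemma coeff_eq_narayana (A : ℕ → ℚ[X]) (h0 : A 0 = 1)
    (hA : ∀ n, A (n + 1) = ∑ p ∈ Finset.HasAntidiagonal.antidiagonal n,
      (if p.1 = 0 then 1 else X) * A p.1 * A p.2) (m k : ℕ) :
    (A (m + 1)).coeff k = narayana (m + 1) k := by
  have h1 : A 1 = 1 := by simp [hA 0, h0]
  have h2 : A 2 = 1 + X := by
    simp [hA 1, h0, h1, Finset.Nat.antidiagonal_succ]
  induction m using Nat.twoStepInduction generalizing k with
  | zero => rcases k with _ | k <;> simp [h1, narayana, coeff_one, Nat.choose_eq_zero_of_lt]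
  | one =>
    rcases k with _ | _ | k <;>
      simp [h2, narayana, coeff_one, coeff_X, Nat.choose_eq_zero_of_lt]
  | more m ih1 ih2 =>
    have h := congrArg (coeff · k) (three_term_recurrence X_ne_zero A h0 hA m)
    rw [show (m : ℚ[X]) + 4 = C ((m : ℚ) + 4) by simp [map_ofNat C],
      show (2 * (m : ℚ[X]) + 5) = C (2 * (m : ℚ) + 5) by simp [map_ofNat C],
      show ((m : ℚ[X]) + 1) = C ((m : ℚ) + 1) by simp,
      show (1 + X) * A (m + 2) = A (m + 2) + X * A (m + 2) by ring,
      show (1 - X) ^ 2 * A (m + 1) =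
        A (m + 1) - C 2 * (X * A (m + 1)) + X * (X * A (m + 1)) by rw [map_ofNat]; ring] at h
    have hne : (m : ℚ) + 4 ≠ 0 := by positivity
    refine mul_left_cancel₀ hne ?_
    rcases k with _ | _ | k
    · simp only [coeff_sub, coeff_add, coeff_C_mul, coeff_X_mul_zero, ih1, ih2] at h
      rw [narayana_recurrence_zero, h]
      ring
    · simp only [coeff_sub, coeff_add, coeff_C_mul, coeff_X_mul, coeff_X_mul_zero, ih1, ih2] at h
      rw [narayana_recurrence_one, h]
      ring
    · simp only [coeff_sub, coeff_add, coeff_C_mul, coeff_X_mul, ih1, ih2] at h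
      rw [narayana_recurrence_add_two, h]

/-- The number of ascents of a list. -/
def listAsc : List ℤ → ℕ
  | a :: b :: l => (if a < b then 1 else 0) + listAsc (b :: l)
  | _ => 0

/-- A list avoids the pattern 1-3-2. -/
def ListAvoids132 (w : List ℤ) : Prop :=
  w.Triplewise fun a b c => ¬(a < c ∧ c < b)

open scoped Classical in
/-- The arrangements of the integers `c+1,…,c+n` that avoid 1-3-2. -/
noncomputable def avoiders (n : ℕ) (c : ℤ) : Finset (List ℤ) :=
  (Finset.Ioc c (c + n)).val.lists.toFinset.filter ListAvoids132

open scoped Classical in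
lemma mem_avoiders {n : ℕ} {c : ℤ} {w : List ℤ} :
    w ∈ avoiders n c ↔ (w.Nodup ∧ ∀ x, x ∈ w ↔ c < x ∧ x ≤ c + n) ∧ ListAvoids132 w := by
  rw [avoiders, Finset.mem_filter, Multiset.mem_toFinset, Multiset.mem_lists_iff, Multiset.quot_mk_to_coe]
  refine and_congr_left fun _ => ⟨fun h => ⟨?_, fun x => ?_⟩, fun ⟨h1, h2⟩ => ?_⟩
  · rw [← Multiset.coe_nodup, ← h]; exact Finset.nodup _
  · rw [← Multiset.mem_coe, ← h]; simp
  · rw [Multiset.Nodup.ext (Finset.nodup _) (Multiset.coe_nodup.2 h1)]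
    simp [h2]

lemma length_of_mem_avoiders {n : ℕ} {c : ℤ} {w : List ℤ} (h : w ∈ avoiders n c) :
    w.length = n := by
  obtain ⟨⟨h1, h2⟩, -⟩ := mem_avoiders.1 h
  have : w.toFinset = Finset.Ioc c (c + n) := by ext x; simp [h2]
  rw [← List.toFinset_card_of_nodup h1, this]
  simp

lemma avoiders_zero (c : ℤ) : avoiders 0 c = {[]} := by
  ext w
  rw [Finset.mem_singleton]
  refine ⟨fun h => List.length_eq_zero_iff.1 (length_of_mem_avoiders h), ?_⟩
  rintro rfl
  simp [mem_avoiders, ListAvoids132]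

lemma listAsc_cons_of_forall_lt {M : ℤ} {R : List ℤ} (hR : ∀ x ∈ R, x < M) :
    listAsc (M :: R) = listAsc R := by
  rcases R with _ | ⟨b, R⟩
  · rfl
  · simp [listAsc, (hR b (by simp)).le]

lemma listAsc_append_cons {M : ℤ} {L R : List ℤ} (hL : ∀ x ∈ L, x < M) (hR : ∀ x ∈ R, x < M) :
    listAsc (L ++ M :: R) = listAsc L + listAsc R + if L = [] then 0 else 1 := by
  induction L with
  | nil => simp [listAsc_cons_of_forall_lt hR, listAsc]
  | cons a L ih =>
    have ih := ih fun x hx => hL x (by simp [hx])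
    rcases L with _ | ⟨b, L⟩
    · have := hL a (by simp)
      simp [listAsc, this, listAsc_cons_of_forall_lt hR, add_comm]
    · simp only [List.cons_append, listAsc, reduceCtorEq, if_false] at ih ⊢
      omega

/-- Gluing avoiders around a new maximum, with all values on the left above those on the right. -/
lemma append_cons_mem_avoiders {i j : ℕ} {c : ℤ} {L R : List ℤ} (hL : L ∈ avoiders i (c + j))
    (hR : R ∈ avoiders j c) :
    L ++ (c + (i + j : ℕ) + 1) :: R ∈ avoiders (i + j + 1) c := by
  obtain ⟨⟨hL1, hL2⟩, hL3⟩ := mem_avoiders.1 hL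
  obtain ⟨⟨hR1, hR2⟩, hR3⟩ := mem_avoiders.1 hR
  push_cast
  refine mem_avoiders.2 ⟨⟨?_, fun x => ?_⟩, ?_⟩
  · rw [List.nodup_append]
    refine ⟨hL1, List.nodup_cons.2 ⟨?_, hR1⟩, ?_⟩
    · rw [hR2]; omega
    · intro a ha b hb
      rw [hL2] at ha
      rcases List.mem_cons.1 hb with rfl | hb
      · omega
      · rw [hR2] at hb; omega
  · rw [List.mem_append, List.mem_cons, hL2, hR2]
    push_cast
    omega
  · unfold ListAvoids132 at *
    rw [List.triplewise_append, List.triplewise_cons]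
    refine ⟨hL3, ⟨?_, hR3⟩, fun a ha => ?_, fun a ha => ?_⟩
    · refine List.pairwise_of_forall_mem_list fun a ha b hb => ?_
      rw [hR2] at ha hb; omega
    · rw [hL2] at ha
      refine List.pairwise_cons.2 ⟨fun b hb => ?_,
        List.pairwise_of_forall_mem_list fun x hx b hb => ?_⟩
      · rw [hR2] at hb; omega
      · rw [hR2] at hx hb; omega
    · refine List.pairwise_of_forall_mem_list fun x hx b hb => ?_
      rw [List.mem_cons, hR2] at ha
      rw [hL2] at hx hb; omega

/-- Every nonempty avoider splits at its maximum into two avoiders. -/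
lemma exists_of_mem_avoiders {n : ℕ} {c : ℤ} {w : List ℤ} (hw : w ∈ avoiders (n + 1) c) :
    ∃ i j : ℕ, i + j = n ∧ ∃ L ∈ avoiders i (c + j), ∃ R ∈ avoiders j c,
      L ++ (c + n + 1) :: R = w := by
  have hlen := length_of_mem_avoiders hw
  obtain ⟨⟨h1, h2⟩, h3⟩ := mem_avoiders.1 hw
  push_cast at h2
  obtain ⟨L, R, rfl⟩ := List.append_of_mem ((h2 (c + n + 1)).2 (by omega))
  unfold ListAvoids132 at h3
  rw [List.triplewise_append, List.triplewise_cons] at h3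
  obtain ⟨hL3, ⟨-, hR3⟩, hLR, -⟩ := h3
  rw [List.nodup_append, List.nodup_cons] at h1
  obtain ⟨hL1, ⟨hMR, hR1⟩, hne⟩ := h1
  have hML : c + n + 1 ∉ L := fun h => hne _ h _ (by simp) rfl
  have hlt (a) (ha : a ∈ L) (b) (hb : b ∈ R) : b < a := by
    have hab := (List.pairwise_cons.1 (hLR a ha)).1 b hb
    have := hne a ha b (by simp [hb])
    have := (h2 b).1 (by simp [hb])
    have : b ≠ c + n + 1 := fun h => hMR (h ▸ hb)
    omega
  have hmem (x) : x ∈ L ∨ x ∈ R ↔ c < x ∧ x ≤ c + n := by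
    have := h2 x
    rw [List.mem_append, List.mem_cons] at this
    constructor
    · intro h
      have : x ≠ c + n + 1 := by rintro rfl; tauto
      have : c < x ∧ x ≤ c + (n + 1) := by tauto
      omega
    · intro h
      have : x ≠ c + n + 1 := by omega
      have : c < x ∧ x ≤ c + (n + 1) := by omega
      tauto
  have hlen' : L.length + R.length = n := by
    simp at hlen; omega
  have hRle (x) (hx : x ∈ R) : x ≤ c + R.length := by
    have hsub : Finset.Ioc c x ⊆ R.toFinset := by
      intro y hy
      rw [Finset.mem_Ioc] at hy
      rw [List.mem_toFinset]
      have := (hmem x).1 (Or.inr hx)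
      refine ((hmem y).2 (by omega)).resolve_left fun hyL => ?_
      have := hlt y hyL x hx
      omega
    have := Finset.card_le_card hsub
    rw [List.toFinset_card_of_nodup hR1, Int.card_Ioc] at this
    omega
  have hR (x) : x ∈ R ↔ c < x ∧ x ≤ c + R.length := by
    have hsub : R.toFinset ⊆ Finset.Ioc c (c + R.length) := by
      intro y hy
      rw [List.mem_toFinset] at hy
      exact Finset.mem_Ioc.2 ⟨((hmem y).1 (Or.inr hy)).1, hRle y hy⟩
    have := Finset.eq_of_subset_of_card_le hsub
      (by rw [List.toFinset_card_of_nodup hR1]; simp)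
    rw [← List.mem_toFinset, this, Finset.mem_Ioc]
  have hL (x) : x ∈ L ↔ c + R.length < x ∧ x ≤ c + R.length + L.length := by
    have hx := hmem x
    rw [hR] at hx
    have : x ∈ L → ¬ (c < x ∧ x ≤ c + R.length) := fun h h' =>
      (hlt x h x ((hR x).2 h')).false
    constructor
    · intro h
      have := this h
      have := hx.1 (Or.inl h)
      omega
    · intro h
      exact (hx.2 (by omega)).resolve_right (by omega)
  exact ⟨L.length, R.length, hlen', L, mem_avoiders.2 ⟨⟨hL1, hL⟩, hL3⟩, R,
    mem_avoiders.2 ⟨⟨hR1, hR⟩, hR3⟩, rfl⟩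

open Polynomial in
/-- The ascent enumerator of the 1-3-2-avoiding arrangements of `c+1,…,c+n`. -/
noncomputable def ascPoly (n : ℕ) (c : ℤ) : ℚ[X] := ∑ w ∈ avoiders n c, X ^ listAsc w

open Polynomial in
lemma ascPoly_succ (n : ℕ) (c : ℤ) :
    ascPoly (n + 1) c = ∑ p ∈ Finset.HasAntidiagonal.antidiagonal n,
      (if p.1 = 0 then 1 else X) * ascPoly p.1 (c + p.2) * ascPoly p.2 c := by
  have hrw (p : ℕ × ℕ) : (if p.1 = 0 then 1 else X) * ascPoly p.1 (c + p.2) * ascPoly p.2 c =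
      ∑ q ∈ avoiders p.1 (c + p.2) ×ˢ avoiders p.2 c,
        (if p.1 = 0 then 1 else X) * X ^ listAsc q.1 * X ^ listAsc q.2 := by
    rw [Finset.sum_product, ascPoly, ascPoly, mul_assoc, Finset.sum_mul_sum, Finset.mul_sum]
    simp only [Finset.mul_sum, mul_assoc]
  simp_rw [hrw]
  rw [Finset.sum_sigma', ascPoly]
  symm
  refine Finset.sum_bij (fun q _ => q.2.1 ++ (c + n + 1) :: q.2.2) ?_ ?_ ?_ ?_
  · rintro ⟨⟨i, j⟩, L, R⟩ h
    simp only [Finset.mem_sigma, Finset.mem_product, Finset.HasAntidiagonal.mem_antidiagonal] at h ⊢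
    obtain ⟨rfl, hL, hR⟩ := h
    exact append_cons_mem_avoiders hL hR
  · rintro ⟨⟨i, j⟩, L, R⟩ h ⟨⟨i', j'⟩, L', R'⟩ h' heq
    simp only [Finset.mem_sigma, Finset.mem_product, Finset.HasAntidiagonal.mem_antidiagonal] at h h' heq
    obtain ⟨hn, hL, hR⟩ := h
    obtain ⟨hn', hL', hR'⟩ := h'
    have key {i j : ℕ} (hn : i + j = n) {L R} (hL : L ∈ avoiders i (c + j))
        (hR : R ∈ avoiders j c) : c + n + 1 ∉ L ∧ c + n + 1 ∉ R := by
      rw [(mem_avoiders.1 hL).1.2, (mem_avoiders.1 hR).1.2]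
      omega
    rw [List.append_cons_inj_of_notMem (key hn hL hR).1 (key hn hL hR).2] at heq
    obtain ⟨rfl, -, rfl⟩ := heq
    obtain rfl := (length_of_mem_avoiders hL).symm.trans (length_of_mem_avoiders hL')
    obtain rfl := (length_of_mem_avoiders hR).symm.trans (length_of_mem_avoiders hR')
    rfl
  · intro w hw
    obtain ⟨i, j, hn, L, hL, R, hR, rfl⟩ := exists_of_mem_avoiders hw
    exact ⟨⟨(i, j), L, R⟩, by simp [hn, hL, hR], rfl⟩
  · rintro ⟨⟨i, j⟩, L, R⟩ h
    simp only [Finset.mem_sigma, Finset.mem_product, Finset.HasAntidiagonal.mem_antidiagonal] at h ⊢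
    obtain ⟨rfl, hL, hR⟩ := h
    rw [listAsc_append_cons]
    · have : L = [] ↔ i = 0 := by rw [← length_of_mem_avoiders hL, List.length_eq_zero_iff]
      simp only [this]
      split_ifs <;> ring
    · intro x hx
      rw [(mem_avoiders.1 hL).1.2] at hx
      push_cast; omega
    · intro x hx
      rw [(mem_avoiders.1 hR).1.2] at hx
      push_cast; omega

lemma ascPoly_eq_ascPoly_zero (n : ℕ) (c : ℤ) : ascPoly n c = ascPoly n 0 := by
  induction n using Nat.strong_induction_on generalizing c with
  | _ n ih =>
    rcases n with _ | n
    · simp [ascPoly, avoiders_zero]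
    · rw [ascPoly_succ, ascPoly_succ]
      refine Finset.sum_congr rfl fun p hp => ?_
      rw [Finset.HasAntidiagonal.mem_antidiagonal] at hp
      rw [ih p.1 (by omega), ih p.2 (by omega), ih p.1 (by omega) (0 + p.2)]

lemma asc_eq_listAsc {m : ℕ} (w : Fin m → ℤ) : asc w = listAsc (List.ofFn w) := by
  have key {m : ℕ} (w : Fin m → ℤ) :
      asc w = ∑ i : Fin m, ∑ j : Fin m, if (j : ℕ) = (i : ℕ) + 1 ∧ w i < w j then 1 else 0 := by
    rw [asc, Nat.card_eq_fintype_card, Fintype.card_subtype, Finset.card_filter,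
      ← Fintype.sum_prod_type']
  rw [key]
  induction m with
  | zero => simp [listAsc]
  | succ m ih =>
    rcases m with _ | m
    · simp [listAsc]
    · have ih := ih fun i => w i.succ
      rw [List.ofFn_succ] at ih ⊢
      rw [List.ofFn_succ, listAsc, ← ih, Fin.sum_univ_succ]
      congr 1
      · rw [Fin.sum_univ_succ, Fin.sum_univ_succ]
        simp
        rfl
      · refine Finset.sum_congr rfl fun i _ => ?_
        rw [Fin.sum_univ_succ]
        simp

lemma ofFn_mem_avoiders {n : ℕ} {π : Fin n → ℤ} :
    List.ofFn π ∈ avoiders n 0 ↔ IsPermSeq n π ∧ Avoids132 π := by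
  rw [mem_avoiders, List.nodup_ofFn, IsPermSeq]
  refine and_congr (and_congr_right fun hinj => ⟨fun h i => ?_, fun h x => ?_⟩) ?_
  · have := (h (π i)).1 (by simp)
    omega
  · have hsub : Finset.univ.image π ⊆ Finset.Ioc 0 (n : ℤ) := by
      intro y hy
      obtain ⟨i, -, rfl⟩ := Finset.mem_image.1 hy
      have := h i
      rw [Finset.mem_Ioc]
      omega
    have := Finset.eq_of_subset_of_card_le hsub
      (by rw [Finset.card_image_of_injective _ hinj]; simp)
    have hx := Finset.ext_iff.1 this x
    simpa [List.mem_ofFn] using hx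
  · rw [ListAvoids132, List.triplewise_iff_getElem]
    simp only [List.getElem_ofFn, List.length_ofFn]
    exact ⟨fun h i j k hij hjk => h i j k hij hjk k.2,
      fun h i j k hij hjk hk => h ⟨i, _⟩ ⟨j, _⟩ ⟨k, hk⟩ hij hjk⟩

open Polynomial in
lemma card_eq_coeff_ascPoly (n k : ℕ) :
    (Nat.card {π : Fin n → ℤ // IsPermSeq n π ∧ Avoids132 π ∧ asc π = k} : ℚ) =
      (ascPoly n 0).coeff k := by
  have hcard : Nat.card {π : Fin n → ℤ // IsPermSeq n π ∧ Avoids132 π ∧ asc π = k} =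
      ((avoiders n 0).filter (listAsc · = k)).card := by
    rw [← Fintype.card_coe, ← Nat.card_eq_fintype_card]
    refine Nat.card_congr (Equiv.ofBijective (fun π => ⟨List.ofFn π.1, ?_⟩) ⟨?_, ?_⟩)
    · rw [Finset.mem_filter, ofFn_mem_avoiders, ← asc_eq_listAsc]
      exact ⟨⟨π.2.1, π.2.2.1⟩, π.2.2.2⟩
    · intro π ρ h
      exact Subtype.ext (List.ofFn_injective (Subtype.ext_iff.1 h))
    · rintro ⟨w, hw⟩
      obtain ⟨hw1, hw2⟩ := Finset.mem_filter.1 hw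
      obtain ⟨π, rfl⟩ : ∃ π : Fin n → ℤ, List.ofFn π = w := by
        obtain rfl := length_of_mem_avoiders hw1
        exact ⟨_, List.ofFn_get w⟩
      rw [ofFn_mem_avoiders] at hw1
      exact ⟨⟨π, hw1.1, hw1.2, (asc_eq_listAsc π).trans hw2⟩, rfl⟩
  rw [hcard, ascPoly, finsetSum_coeff, Finset.card_filter]
  push_cast
  refine Finset.sum_congr rfl fun w _ => ?_
  rw [coeff_X_pow]
  simp only [eq_comm]

/-- For `n ≥ 1` and `0 ≤ k ≤ n-1`, the number of 1-3-2-avoiding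
permutations of length `n` with exactly `k` ascents is the Narayana number
`N(n,k) = (1/n)·C(n,k)·C(n,k+1)`. -/
theorem card_avoids132_asc_eq_narayana (n k : ℕ) (hn : 1 ≤ n) (hk : k ≤ n - 1) :
    (Nat.card {π : Fin n → ℤ // IsPermSeq n π ∧ Avoids132 π ∧ asc π = k} : ℚ) =
      ((n.choose k : ℚ) * (n.choose (k + 1) : ℚ)) / n := by
  obtain ⟨m, rfl⟩ : ∃ m, n = m + 1 := ⟨n - 1, by omega⟩
  rw [card_eq_coeff_ascPoly]
  refine coeff_eq_narayana (fun n => ascPoly n 0) ?_ (fun n => ?_) m k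
  · simp [ascPoly, avoiders_zero, listAsc]
  · rw [ascPoly_succ]
    simp only [ascPoly_eq_ascPoly_zero _ (0 + _)]
end

section
/- For all n ≥ 0 and k ≥ 0, the number of permutations of length n avoiding the pattern 1-3-2 with exactly k ascents equals the number of permutations of length n avoiding the pattern 1-3-2 with exactly k descents. -/
namespace List

/-- The number of pairs of adjacent entries of a list that are related by `r`. -/
def adjCount (r : ℤ → ℤ → Prop) [DecidableRel r] : List ℤ → ℕ
  | [] => 0
  | a :: l => (if ∃ b ∈ l.head?, r a b then 1 else 0) + adjCount r l

/-- A list of integers avoids the pattern 1-3-2. -/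
def Avoids132 : List ℤ → Prop
  | [] => True
  | a :: l => l.Pairwise (fun b c => ¬(a < c ∧ c < b)) ∧ Avoids132 l

/-- The entries of `l` are the integers in `(c, c + l.length]`, each occurring once. -/
def IsPermFrom (c : ℤ) (l : List ℤ) : Prop :=
  l.Nodup ∧ ∀ x ∈ l, c < x ∧ x ≤ c + l.length

variable {L R : List ℤ} {m : ℤ}

theorem avoids132_append_cons_iff (hL : ∀ x ∈ L, x < m) (hR : ∀ x ∈ R, x < m) :
    (L ++ m :: R).Avoids132 ↔ L.Avoids132 ∧ R.Avoids132 ∧ ∀ x ∈ L, ∀ y ∈ R, y ≤ x := by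
  induction L with
  | nil =>
    simp only [nil_append, Avoids132, not_mem_nil, IsEmpty.forall_iff, implies_true, and_true,
      true_and, and_iff_right_iff_imp]
    intro _
    refine pairwise_of_forall_mem_list ?_
    intro b _ c hc h
    exact absurd (hR c hc) (by omega)
  | cons a L ih =>
    have ih := ih fun x hx => hL x (mem_cons_of_mem _ hx)
    simp only [cons_append, Avoids132, ih, pairwise_append, pairwise_cons, mem_cons,
      forall_eq_or_imp]
    have ha := hL a mem_cons_self
    constructor
    · rintro ⟨⟨h1, ⟨h2, h3⟩, h4⟩, h5, h6, h7⟩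
      refine ⟨⟨h1, h5⟩, h6, fun y hy => ?_, h7⟩
      have := h2 y hy
      have := hR y hy
      omega
    · rintro ⟨⟨h1, h5⟩, h6, h8, h7⟩
      refine ⟨⟨h1, ⟨fun y hy => ?_, ?_⟩, fun b hb => ⟨?_, fun y hy => ?_⟩⟩, h5, h6, h7⟩
      · have := h8 y hy
        omega
      · refine pairwise_of_forall_mem_list ?_
        intro b _ c hc h
        have := h8 c hc
        omega
      · have := hL b (mem_cons_of_mem _ hb)
        omega
      · have := h8 y hy
        omega

theorem adjCount_cons_cons (r : ℤ → ℤ → Prop) [DecidableRel r] (a b : ℤ) (l : List ℤ) :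
    (a :: b :: l).adjCount r = (if r a b then 1 else 0) + (b :: l).adjCount r := by
  simp [adjCount]

theorem adjCount_lt_append_cons (hL : ∀ x ∈ L, x < m) (hR : ∀ x ∈ R, x < m) :
    (L ++ m :: R).adjCount (· < ·) =
      L.adjCount (· < ·) + (if L.length = 0 then 0 else 1) + R.adjCount (· < ·) := by
  induction L with
  | nil =>
    cases R with
    | nil => simp [adjCount]
    | cons b R => simp [adjCount, (hR b mem_cons_self).le]
  | cons a L ih =>
    have ih := ih fun x hx => hL x (mem_cons_of_mem _ hx)
    cases L with
    | nil =>
      have := hL a mem_cons_self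
      simp_all [adjCount]
    | cons b L =>
      rw [cons_append, cons_append, adjCount_cons_cons, ← cons_append, ih, adjCount_cons_cons]
      simp only [length_cons, Nat.add_eq_zero_iff, one_ne_zero, and_false]
      omega

theorem adjCount_gt_append_cons (hL : ∀ x ∈ L, x < m) (hR : ∀ x ∈ R, x < m) :
    (L ++ m :: R).adjCount (· > ·) =
      L.adjCount (· > ·) + (if R.length = 0 then 0 else 1) + R.adjCount (· > ·) := by
  induction L with
  | nil =>
    cases R with
    | nil => simp [adjCount]
    | cons b R => simp [adjCount, hR b mem_cons_self]
  | cons a L ih =>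
    have ih := ih fun x hx => hL x (mem_cons_of_mem _ hx)
    cases L with
    | nil =>
      have := hL a mem_cons_self
      simp_all [adjCount, this.le]
    | cons b L =>
      rw [cons_append, cons_append, adjCount_cons_cons, ← cons_append, ih, adjCount_cons_cons]
      omega

theorem Nodup.length_le_of_mem_Ioc {l : List ℤ} (hl : l.Nodup) {a b : ℤ} (hab : a ≤ b)
    (h : ∀ x ∈ l, a < x ∧ x ≤ b) : (l.length : ℤ) ≤ b - a := by
  have h1 : l.toFinset ⊆ Finset.Ioc a b := fun x hx =>
    Finset.mem_Ioc.2 (h x (mem_toFinset.1 hx))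
  have h2 := Finset.card_le_card h1
  rw [toFinset_card_of_nodup hl, Int.card_Ioc] at h2
  omega

/-- Splitting a nonempty 1-3-2-avoiding permutation at its largest entry. -/
theorem IsPermFrom.exists_append_cons {c : ℤ} {l : List ℤ} (hl : l.IsPermFrom c)
    (hav : l.Avoids132) (hne : l ≠ []) :
    ∃ L R, l = L ++ (c + L.length + R.length + 1) :: R ∧
      L.IsPermFrom (c + R.length) ∧ L.Avoids132 ∧ R.IsPermFrom c ∧ R.Avoids132 := by
  obtain ⟨hnd, hmem⟩ := hl
  have hmax : c + l.length ∈ l := by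
    by_contra hcon
    have hpos := length_pos_of_ne_nil hne
    have := hnd.length_le_of_mem_Ioc (a := c) (b := c + l.length - 1) (by omega) fun x hx => by
      have hxl : x ≠ c + l.length := by rintro rfl; exact hcon hx
      have := hmem x hx
      omega
    omega
  obtain ⟨L, R, hlr⟩ := append_of_mem hmax
  have hlen : (l.length : ℤ) = L.length + R.length + 1 := by
    rw [hlr]; simp; omega
  have hm : c + (l.length : ℤ) = c + L.length + R.length + 1 := by omega
  rw [hm] at hlr
  rw [hlr] at hnd hav
  simp only [nodup_append, nodup_cons, mem_cons, forall_eq_or_imp] at hnd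
  obtain ⟨hLn, ⟨hmR, hRn⟩, hdisj⟩ := hnd
  have hL : ∀ x ∈ L, c < x ∧ x < c + L.length + R.length + 1 := fun x hx => by
    have h1 := hmem x (by simp [hlr, hx])
    have h2 := (hdisj x hx).1
    omega
  have hR : ∀ x ∈ R, c < x ∧ x < c + L.length + R.length + 1 := fun x hx => by
    have h1 := hmem x (by simp [hlr, hx])
    have h2 : x ≠ c + L.length + R.length + 1 := by rintro rfl; exact hmR hx
    omega
  rw [avoids132_append_cons_iff (fun x hx => (hL x hx).2) fun x hx => (hR x hx).2] at hav
  obtain ⟨hLa, hRa, hLR⟩ := hav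
  have hlt : ∀ x ∈ L, ∀ y ∈ R, y < x := fun x hx y hy =>
    lt_of_le_of_ne (hLR x hx y hy) fun h => (hdisj x hx).2 y hy h.symm
  refine ⟨L, R, hlr, ⟨hLn, fun x hx => ⟨?_, ?_⟩⟩, hLa, ⟨hRn, fun y hy => ⟨(hR y hy).1, ?_⟩⟩, hRa⟩
  · have := hRn.length_le_of_mem_Ioc (a := c) (b := x - 1) (by have := hL x hx; omega)
      fun y hy => by
        have := hlt x hx y hy
        have := hR y hy
        omega
    omega
  · have := hL x hx
    omega
  · have := hLn.length_le_of_mem_Ioc (a := y) (b := c + L.length + R.length)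
      (by have := hR y hy; omega) fun x hx => by
        have := hlt x hx y hy
        have := hL x hx
        omega
    omega

end List

namespace BinaryTree

/-- The 1-3-2-avoiding permutation of `(c, c + t.numNodes]` encoded by `t`: its largest entry is
the root, and the entries before and after it are encoded by the left and the right subtree. -/
def toPerm : BinaryTree Unit → ℤ → List ℤ
  | nil, _ => []
  | node _ l r, c =>
    toPerm l (c + r.numNodes) ++ (c + l.numNodes + r.numNodes + 1) :: toPerm r c

/-- The number of nodes with a nonempty left subtree. -/
def leftEdges : BinaryTree Unit → ℕ
  | nil => 0
  | node _ l r => leftEdges l + (if l.numNodes = 0 then 0 else 1) + leftEdges r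

/-- The number of nodes with a nonempty right subtree. -/
def rightEdges : BinaryTree Unit → ℕ
  | nil => 0
  | node _ l r => rightEdges l + (if r.numNodes = 0 then 0 else 1) + rightEdges r

/-- The mirror image of a binary tree. -/
def mirror : BinaryTree Unit → BinaryTree Unit
  | nil => nil
  | node a l r => node a (mirror r) (mirror l)

theorem mirror_involutive : Function.Involutive mirror := fun t => by
  induction t with
  | nil => rfl
  | node a l r hl hr => simp [mirror, hl, hr]

@[simp]
theorem numNodes_mirror (t : BinaryTree Unit) : t.mirror.numNodes = t.numNodes := by
  induction t with
  | nil => rfl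
  | node a l r hl hr => simp [mirror, hl, hr, add_comm]

@[simp]
theorem rightEdges_mirror (t : BinaryTree Unit) : t.mirror.rightEdges = t.leftEdges := by
  induction t with
  | nil => rfl
  | node a l r hl hr =>
    simp only [mirror, rightEdges, leftEdges, hl, hr, numNodes_mirror]
    omega

@[simp]
theorem length_toPerm (t : BinaryTree Unit) (c : ℤ) : (t.toPerm c).length = t.numNodes := by
  induction t generalizing c with
  | nil => rfl
  | node a l r hl hr => simp [toPerm, hl, hr, add_assoc]

theorem bounds_of_mem_toPerm {t : BinaryTree Unit} {c x : ℤ} (hx : x ∈ t.toPerm c) :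
    c < x ∧ x ≤ c + t.numNodes := by
  induction t generalizing c with
  | nil => simp [toPerm] at hx
  | node a l r hl hr =>
    simp only [toPerm, List.mem_append, List.mem_cons] at hx
    simp only [numNodes]
    push_cast
    rcases hx with hx | rfl | hx
    · have := hl hx
      omega
    · omega
    · have := hr hx
      omega

theorem lt_of_mem_toPerm_left {l r : BinaryTree Unit} {c : ℤ} :
    ∀ x ∈ l.toPerm (c + r.numNodes), x < c + l.numNodes + r.numNodes + 1 := fun x hx => by
  have := bounds_of_mem_toPerm hx
  omega

theorem lt_of_mem_toPerm_right {l r : BinaryTree Unit} {c : ℤ} :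
    ∀ x ∈ r.toPerm c, x < c + l.numNodes + r.numNodes + 1 := fun x hx => by
  have := bounds_of_mem_toPerm hx
  omega

theorem nodup_toPerm (t : BinaryTree Unit) (c : ℤ) : (t.toPerm c).Nodup := by
  induction t generalizing c with
  | nil => simp [toPerm]
  | node a l r hl hr =>
    simp only [toPerm, List.nodup_append, List.nodup_cons, List.mem_cons, forall_eq_or_imp]
    refine ⟨hl _, ⟨fun h => (lt_of_mem_toPerm_right _ h).ne rfl, hr _⟩,
      fun x hx => ⟨(lt_of_mem_toPerm_left x hx).ne, fun y hy => ?_⟩⟩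
    have := bounds_of_mem_toPerm hx
    have := bounds_of_mem_toPerm hy
    omega

theorem isPermFrom_toPerm (t : BinaryTree Unit) (c : ℤ) : (t.toPerm c).IsPermFrom c :=
  ⟨nodup_toPerm t c, fun x hx => by
    rw [length_toPerm]
    exact bounds_of_mem_toPerm hx⟩

theorem avoids132_toPerm (t : BinaryTree Unit) (c : ℤ) : (t.toPerm c).Avoids132 := by
  induction t generalizing c with
  | nil => trivial
  | node a l r hl hr =>
    rw [toPerm, List.avoids132_append_cons_iff lt_of_mem_toPerm_left lt_of_mem_toPerm_right]
    refine ⟨hl _, hr _, fun x hx y hy => ?_⟩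
    have := bounds_of_mem_toPerm hx
    have := bounds_of_mem_toPerm hy
    omega

theorem adjCount_lt_toPerm (t : BinaryTree Unit) (c : ℤ) :
    (t.toPerm c).adjCount (· < ·) = t.leftEdges := by
  induction t generalizing c with
  | nil => rfl
  | node a l r hl hr =>
    rw [toPerm, List.adjCount_lt_append_cons lt_of_mem_toPerm_left lt_of_mem_toPerm_right,
      hl, hr, length_toPerm, leftEdges]

theorem adjCount_gt_toPerm (t : BinaryTree Unit) (c : ℤ) :
    (t.toPerm c).adjCount (· > ·) = t.rightEdges := by
  induction t generalizing c with
  | nil => rfl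
  | node a l r hl hr =>
    rw [toPerm, List.adjCount_gt_append_cons lt_of_mem_toPerm_left lt_of_mem_toPerm_right,
      hl, hr, length_toPerm, rightEdges]

theorem toPerm_injective (c : ℤ) : Function.Injective fun t : BinaryTree Unit => t.toPerm c := by
  intro t t' h
  induction t generalizing c t' with
  | nil =>
    cases t' with
    | nil => rfl
    | node a l r => simp [toPerm] at h
  | node a l r hl hr =>
    cases t' with
    | nil => simp [toPerm] at h
    | node a' l' r' =>
      have hn : (l.numNodes + r.numNodes + 1 : ℤ) = l'.numNodes + r'.numNodes + 1 := by
        have := congrArg List.length h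
        simp only [length_toPerm, numNodes] at this
        exact_mod_cast this
      have hm : c + l.numNodes + r.numNodes + 1 = c + l'.numNodes + r'.numNodes + 1 := by omega
      simp only [toPerm] at h
      rw [List.append_cons_inj_of_notMem
        (fun hx => by have := lt_of_mem_toPerm_left _ hx; omega)
        (fun hx => by have := lt_of_mem_toPerm_right (l := l) _ hx; omega)] at h
      obtain ⟨h1, -, h2⟩ := h
      obtain rfl := hr c h2
      obtain rfl := hl _ h1
      rfl

theorem exists_toPerm_eq {c : ℤ} {l : List ℤ} (hl : l.IsPermFrom c) (hav : l.Avoids132) :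
    ∃ t : BinaryTree Unit, t.toPerm c = l := by
  induction hn : l.length using Nat.strong_induction_on generalizing l c with
  | _ n ih =>
    by_cases hne : l = []
    · exact ⟨nil, hne.symm⟩
    · obtain ⟨L, R, rfl, hL, hLa, hR, hRa⟩ := hl.exists_append_cons hav hne
      simp only [List.length_append, List.length_cons] at hn
      obtain ⟨tl, htl⟩ := ih L.length (by omega) hL hLa rfl
      obtain ⟨tr, htr⟩ := ih R.length (by omega) hR hRa rfl
      have hln : tl.numNodes = L.length := by rw [← htl, length_toPerm]
      have hrn : tr.numNodes = R.length := by rw [← htr, length_toPerm]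
      exact ⟨node () tl tr, by rw [toPerm, hln, hrn, htl, htr]⟩

end BinaryTree

theorem avoids132_ofFn {n : ℕ} (w : Fin n → ℤ) : (List.ofFn w).Avoids132 ↔ Avoids132 w := by
  induction n with
  | zero => simp [List.Avoids132, Avoids132]
  | succ n ih =>
    rw [List.ofFn_succ, List.Avoids132, ih, List.pairwise_ofFn]
    simp only [Avoids132]
    constructor
    · rintro ⟨h0, hs⟩ i j k hij hjk
      obtain ⟨j, rfl⟩ := Fin.exists_succ_eq.2 (Fin.ne_zero_of_lt hij)
      obtain ⟨k, rfl⟩ := Fin.exists_succ_eq.2 (Fin.ne_zero_of_lt hjk)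
      rw [Fin.succ_lt_succ_iff] at hjk
      cases i using Fin.cases with
      | zero => exact h0 hjk
      | succ i => exact hs i j k (Fin.succ_lt_succ_iff.1 hij) hjk
    · exact fun h => ⟨fun j k hjk => h 0 j.succ k.succ j.succ_pos (Fin.succ_lt_succ_iff.2 hjk),
        fun i j k hij hjk => h _ _ _ (Fin.succ_lt_succ_iff.2 hij) (Fin.succ_lt_succ_iff.2 hjk)⟩

theorem isPermFrom_ofFn {n : ℕ} (w : Fin n → ℤ) :
    (List.ofFn w).IsPermFrom 0 ↔ IsPermSeq n w := by
  simp only [List.IsPermFrom, List.nodup_ofFn, List.forall_mem_ofFn_iff, List.length_ofFn,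
    IsPermSeq, zero_add, Int.lt_iff_add_one_le]

theorem card_adjacent_succ (r : ℤ → ℤ → Prop) [DecidableRel r] {n : ℕ} (w : Fin (n + 1) → ℤ) :
    Nat.card {p : Fin (n + 1) × Fin (n + 1) // (p.2 : ℕ) = (p.1 : ℕ) + 1 ∧ r (w p.1) (w p.2)} =
      ∑ i : Fin n, if r (w i.castSucc) (w i.succ) then 1 else 0 := by
  rw [← Finset.card_filter, ← Fintype.card_subtype, ← Nat.card_eq_fintype_card]
  symm
  refine Nat.card_eq_of_bijective
    (fun i => ⟨(i.1.castSucc, i.1.succ), by simp, i.2⟩) ⟨fun i j h => ?_, ?_⟩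
  · simp only [Subtype.mk.injEq, Prod.mk.injEq, Fin.succ_inj] at h
    exact Subtype.ext h.2
  · rintro ⟨⟨a, b⟩, hab, hr⟩
    obtain ⟨b, rfl⟩ := Fin.exists_succ_eq.2 (show b ≠ 0 by rintro rfl; simp at hab)
    obtain rfl : a = b.castSucc := by
      ext
      simpa using hab.symm
    exact ⟨⟨b, hr⟩, rfl⟩

theorem card_adjacent_eq_adjCount (r : ℤ → ℤ → Prop) [DecidableRel r] {n : ℕ} (w : Fin n → ℤ) :
    Nat.card {p : Fin n × Fin n // (p.2 : ℕ) = (p.1 : ℕ) + 1 ∧ r (w p.1) (w p.2)} =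
      (List.ofFn w).adjCount r := by
  induction n with
  | zero => simp [List.adjCount]
  | succ n ih =>
    rw [List.ofFn_succ, List.adjCount, ← ih, card_adjacent_succ]
    cases n with
    | zero => simp
    | succ n =>
      rw [card_adjacent_succ r fun i : Fin (n + 1) => w i.succ, Fin.sum_univ_succ]
      simp
      congr

theorem asc_eq_adjCount {n : ℕ} (w : Fin n → ℤ) : asc w = (List.ofFn w).adjCount (· < ·) :=
  card_adjacent_eq_adjCount (· < ·) w

theorem des_eq_adjCount {n : ℕ} (w : Fin n → ℤ) : des w = (List.ofFn w).adjCount (· > ·) :=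
  card_adjacent_eq_adjCount (· > ·) w

theorem card_avoids132_eq_card_binaryTree (n : ℕ) (P : List ℤ → Prop) :
    Nat.card {π : Fin n → ℤ // IsPermSeq n π ∧ Avoids132 π ∧ P (List.ofFn π)} =
      Nat.card {t : BinaryTree Unit // t.numNodes = n ∧ P (t.toPerm 0)} := by
  have key : ∀ t : BinaryTree Unit, t.numNodes = n →
      ∃ π : Fin n → ℤ, List.ofFn π = t.toPerm 0 := by
    rintro t rfl
    rw [← t.length_toPerm 0]
    exact ⟨_, List.ofFn_get _⟩
  choose f hf using key
  symm
  refine Nat.card_eq_of_bijective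
    (fun t => ⟨f t.1 t.2.1, by
      rw [← isPermFrom_ofFn, ← avoids132_ofFn, hf]
      exact ⟨t.1.isPermFrom_toPerm 0, t.1.avoids132_toPerm 0, t.2.2⟩⟩)
    ⟨fun t t' h => Subtype.ext (BinaryTree.toPerm_injective 0 ?_), ?_⟩
  · simp only [Subtype.mk.injEq] at h
    simp only [← hf _ t.2.1, ← hf _ t'.2.1, h]
  · rintro ⟨π, hπ, hav, hP⟩
    obtain ⟨t, ht⟩ := BinaryTree.exists_toPerm_eq ((isPermFrom_ofFn π).2 hπ)
      ((avoids132_ofFn π).2 hav)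
    have hn : t.numNodes = n := by rw [← t.length_toPerm 0, ht, List.length_ofFn]
    exact ⟨⟨t, hn, ht ▸ hP⟩, Subtype.ext (List.ofFn_injective ((hf t hn).trans ht))⟩

/-- For all `n, k ≥ 0`, the number of 1-3-2-avoiding permutations
of length `n` with exactly `k` ascents equals the number of 1-3-2-avoiding
permutations of length `n` with exactly `k` descents. -/
theorem card_avoids132_asc_eq_card_des (n k : ℕ) :
    Nat.card {π : Fin n → ℤ // IsPermSeq n π ∧ Avoids132 π ∧ asc π = k} =
      Nat.card {π : Fin n → ℤ // IsPermSeq n π ∧ Avoids132 π ∧ des π = k} := by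
  simp only [asc_eq_adjCount, des_eq_adjCount]
  rw [card_avoids132_eq_card_binaryTree n fun l => l.adjCount (· < ·) = k,
    card_avoids132_eq_card_binaryTree n fun l => l.adjCount (· > ·) = k]
  simp only [BinaryTree.adjCount_lt_toPerm, BinaryTree.adjCount_gt_toPerm]
  exact Nat.card_congr (BinaryTree.mirror_involutive.toPerm.subtypeEquiv fun t => by simp)
end

section
/- For n ≥ 0 define the polynomial A_n(x) = Σ_{π ∈ S_n(1-3-2)} x^{asc(π)} (with A_0 = 1), where asc(π) is the number of ascents of π. Then for all n ≥ 0, A_{n+1}(x) = A_n(x) + x · Σ_{a+b=n, a≥1} A_a(x)·A_b(x). -/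
/-- The extension of a finite sequence to `ℕ` by zero. -/
def extendZero {m : ℕ} (w : Fin m → ℤ) (i : ℕ) : ℤ := if h : i < m then w ⟨i, h⟩ else 0

theorem extendZero_val {m : ℕ} (w : Fin m → ℤ) (i : Fin m) : extendZero w i = w i := by
  simp [extendZero]

theorem extendZero_restrict {m : ℕ} (f : ℕ → ℤ) {i : ℕ} (hi : i < m) :
    extendZero (fun j : Fin m => f j) i = f i := by
  simp [extendZero, hi]

/-- The first `m` values of `f` form a permutation of `1,…,m` avoiding 1-3-2. -/
structure IsAvoidingPerm (m : ℕ) (f : ℕ → ℤ) : Prop where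
  inj : ∀ i j, i < m → j < m → f i = f j → i = j
  pos : ∀ i, i < m → 1 ≤ f i
  le : ∀ i, i < m → f i ≤ m
  avoids : ∀ i j k, i < j → j < k → k < m → f i < f k → f j ≤ f k

theorem isAvoidingPerm_iff {m : ℕ} {f : ℕ → ℤ} :
    IsAvoidingPerm m f ↔
      IsPermSeq m (fun i => f i) ∧ Avoids132 (fun i : Fin m => f i) := by
  constructor
  · intro h
    refine ⟨⟨fun i j hij => Fin.ext (h.inj _ _ i.2 j.2 hij), fun i => ⟨h.pos _ i.2, h.le _ i.2⟩⟩, ?_⟩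
    intro i j k hij hjk hv
    exact absurd (h.avoids i j k hij hjk k.2 hv.1) (not_le.2 hv.2)
  · rintro ⟨⟨hinj, hb⟩, hav⟩
    refine ⟨fun i j hi hj hij => ?_, fun i hi => (hb ⟨i, hi⟩).1, fun i hi => (hb ⟨i, hi⟩).2, ?_⟩
    · exact congrArg Fin.val (@hinj ⟨i, hi⟩ ⟨j, hj⟩ hij)
    · intro i j k hij hjk hk h1
      by_contra! h2
      exact hav ⟨i, by omega⟩ ⟨j, by omega⟩ ⟨k, hk⟩ hij hjk ⟨h1, h2⟩

/-- The set of permutations of length `m` avoiding 1-3-2. -/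
def avoidingPerms (m : ℕ) : Set (Fin m → ℤ) := {w | IsPermSeq m w ∧ Avoids132 w}

theorem avoidingPerms_finite (m : ℕ) : (avoidingPerms m).Finite :=
  (Set.Finite.pi' fun _ => Set.finite_Icc (1 : ℤ) m).subset fun _ hw => hw.1.2

theorem mem_avoidingPerms_iff {m : ℕ} {w : Fin m → ℤ} :
    w ∈ avoidingPerms m ↔ IsAvoidingPerm m (extendZero w) := by
  simp [isAvoidingPerm_iff, extendZero_val, avoidingPerms]

theorem restrict_mem_avoidingPerms {m : ℕ} {f : ℕ → ℤ} (h : IsAvoidingPerm m f) :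
    (fun i : Fin m => f i) ∈ avoidingPerms m :=
  isAvoidingPerm_iff.1 h

/-- The number of ascents as a sum of indicators. -/
theorem asc_eq_sum {m : ℕ} {w : Fin m → ℤ} {f : ℕ → ℤ} (hf : ∀ i : Fin m, w i = f i) :
    asc w = ∑ i ∈ Finset.range (m - 1), if f i < f (i + 1) then 1 else 0 := by
  rw [← Finset.card_filter, asc, ← Nat.card_eq_finsetCard]
  refine Nat.card_congr
    { toFun := fun p => ⟨p.1.1, ?_⟩
      invFun := fun i => ⟨(⟨i.1, ?_⟩, ⟨i.1 + 1, ?_⟩), rfl, ?_⟩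
      left_inv := ?_
      right_inv := fun i => rfl }
  · obtain ⟨⟨p, q⟩, hpq, hlt⟩ := p
    rw [hf, hf, hpq] at hlt
    simp only [Finset.mem_filter, Finset.mem_range]
    exact ⟨by have := q.2; simp only at hpq; omega, hlt⟩
  · have := Finset.mem_range.1 (Finset.mem_filter.1 i.2).1
    omega
  · have := Finset.mem_range.1 (Finset.mem_filter.1 i.2).1
    omega
  · rw [hf, hf]
    exact (Finset.mem_filter.1 i.2).2
  · rintro ⟨⟨p, q⟩, hpq, hlt⟩
    ext
    · rfl
    · exact hpq.symm

/-- The sequence `(σ + (n - a), n + 1, τ)`, where `σ` has length `a` and `τ` has length `n - a`. -/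
def glue (n a : ℕ) (f g : ℕ → ℤ) (i : ℕ) : ℤ :=
  if i < a then f i + (n - a) else if i = a then n + 1 else g (i - a - 1)

theorem IsAvoidingPerm.glue {n a : ℕ} (ha : a ≤ n) {f g : ℕ → ℤ} (hf : IsAvoidingPerm a f)
    (hg : IsAvoidingPerm (n - a) g) : IsAvoidingPerm (n + 1) (glue n a f g) := by
  have left : ∀ i, i < a → 1 ≤ f i ∧ f i ≤ a := fun i hi => ⟨hf.pos i hi, hf.le i hi⟩
  have right : ∀ i, a < i → i < n + 1 → 1 ≤ g (i - a - 1) ∧ g (i - a - 1) ≤ n - a := by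
    intro i hi hin
    have := hg.le (i - a - 1) (by omega)
    exact ⟨hg.pos _ (by omega), by omega⟩
  refine ⟨fun i j hi hj hij => ?_, fun i hi => ?_, fun i hi => ?_,
    fun i j k hij hjk hk h1 => ?_⟩
  · have h1 := hf.inj i j
    have h2 := hg.inj (i - a - 1) (j - a - 1)
    have := left i; have := left j; have := right i; have := right j
    simp only [_root_.glue] at hij
    split_ifs at hij <;> omega
  · have := left i; have := right i
    simp only [_root_.glue]
    split_ifs <;> omega
  · have := left i; have := right i
    simp only [_root_.glue]
    split_ifs <;> omega
  · have h3 := hf.avoids i j k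
    have h4 := hg.avoids (i - a - 1) (j - a - 1) (k - a - 1)
    have := left i; have := left j; have := left k
    have := right i; have := right j; have := right k
    simp only [_root_.glue] at h1 ⊢
    split_ifs at h1 ⊢ <;> omega

theorem sum_ascents_glue {n a : ℕ} (ha : a ≤ n) {f g : ℕ → ℤ} (hf : IsAvoidingPerm a f)
    (hg : IsAvoidingPerm (n - a) g) :
    (∑ i ∈ Finset.range n, if glue n a f g i < glue n a f g (i + 1) then 1 else 0) =
      (∑ i ∈ Finset.range (a - 1), if f i < f (i + 1) then 1 else 0) +
      (∑ i ∈ Finset.range (n - a - 1), if g i < g (i + 1) then 1 else 0) +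
      if a = 0 then 0 else 1 := by
  obtain ⟨b, rfl⟩ := Nat.exists_eq_add_of_le ha
  rw [Nat.add_sub_cancel_left] at hg ⊢
  have tail : (∑ i ∈ Finset.range b, if glue (a + b) a f g (a + i) < glue (a + b) a f g (a + i + 1)
      then 1 else 0) = ∑ i ∈ Finset.range (b - 1), if g i < g (i + 1) then 1 else 0 := by
    cases b with
    | zero => simp
    | succ b =>
      have h0 := hg.le 0 (by omega)
      rw [Finset.sum_range_succ', Nat.add_sub_cancel, if_neg, add_zero]
      · refine Finset.sum_congr rfl fun i _ => ?_
        simp [glue,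
          show a + (i + 1) + 1 - a - 1 = i + 1 by omega, show ¬ a + (i + 1) < a by omega,
          show ¬ a + (i + 1) + 1 < a by omega, show a + (i + 1) + 1 ≠ a by omega]
      · simp [glue]
        push_cast at h0
        omega
  rw [Finset.sum_range_add, tail]
  cases a with
  | zero => simp
  | succ a =>
    have h0 := hf.le a (by omega)
    rw [Finset.sum_range_succ, if_pos]
    · have : ∀ i ∈ Finset.range a, (if glue (a + 1 + b) (a + 1) f g i <
          glue (a + 1 + b) (a + 1) f g (i + 1) then 1 else 0) =
          if f i < f (i + 1) then 1 else 0 := by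
        intro i hi
        have := Finset.mem_range.1 hi
        simp [glue, show i < a + 1 by omega, this]
      rw [Finset.sum_congr rfl this]
      simp
      omega
    · simp [glue]
      push_cast at h0
      omega

theorem le_of_injOn_of_mem_Icc {s : Finset ℕ} {f : ℕ → ℤ} (hf : Set.InjOn f s) {l u : ℤ}
    (h : ∀ i ∈ s, l ≤ f i ∧ f i ≤ u) : s.card ≤ (u + 1 - l).toNat := by
  rw [← Int.card_Icc]
  exact Finset.card_le_card_of_injOn f (fun i hi => by simpa using h i hi) hf

theorem IsAvoidingPerm.exists_eq_max {n : ℕ} {f : ℕ → ℤ} (h : IsAvoidingPerm (n + 1) f) :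
    ∃ a ≤ n, f a = n + 1 := by
  by_contra! hne
  have := le_of_injOn_of_mem_Icc (s := Finset.range (n + 1)) (f := f) (l := 1) (u := n)
    (fun i hi j hj => h.inj i j (by simpa using hi) (by simpa using hj)) (fun i hi => by
      have hi := Finset.mem_range.1 hi
      have := h.pos i hi
      have := h.le i hi
      have := hne i (by omega)
      push_cast at *
      omega)
  simp at this

/-- Every avoiding permutation splits at its maximum. -/
theorem IsAvoidingPerm.exists_glue {n : ℕ} {f : ℕ → ℤ} (h : IsAvoidingPerm (n + 1) f) :
    ∃ a ≤ n, IsAvoidingPerm a (fun i => f i - (n - a)) ∧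
      IsAvoidingPerm (n - a) (fun i => f (a + 1 + i)) ∧ f a = n + 1 := by
  obtain ⟨a, ha, hmax⟩ := h.exists_eq_max
  have hlt : ∀ i, i < n + 1 → i ≠ a → f i < n + 1 := by
    intro i hi hia
    have h1 := h.le i hi
    have h2 := mt (h.inj i a hi (by omega)) hia
    push_cast at h1
    omega
  have cross : ∀ i k, i < a → a < k → k < n + 1 → f k < f i := by
    intro i k hi hk hkn
    have h1 := h.avoids i a k hi hk hkn
    have h2 := hlt k hkn (by omega)
    have h3 := mt (h.inj i k (by omega) hkn) (by omega)
    omega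
  have left : ∀ i, i < a → (n - a : ℤ) + 1 ≤ f i := by
    intro i hi
    have := le_of_injOn_of_mem_Icc (s := Finset.Ioo a (n + 1)) (f := f) (l := 1) (u := f i - 1)
      (fun i hi j hj => h.inj i j (by simp at hi; omega) (by simp at hj; omega)) (fun k hk => by
        have hk := Finset.mem_Ioo.1 hk
        have := h.pos k hk.2
        have := cross i k hi hk.1 hk.2
        omega)
    have := h.pos i (by omega)
    simp at *
    omega
  have right : ∀ k, a < k → k < n + 1 → f k ≤ n - a := by
    intro k hk hkn
    have := le_of_injOn_of_mem_Icc (s := Finset.range (a + 1)) (f := f) (l := f k + 1) (u := n + 1)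
      (fun i hi j hj => h.inj i j (by simp at hi; omega) (by simp at hj; omega)) (fun i hi => by
        have hi := Finset.mem_range.1 hi
        have h1 := h.le i (by omega)
        have h2 := cross i k
        have h3 := hlt k hkn (by omega)
        rcases (show i < a ∨ i = a by omega) with hia | rfl
        · push_cast at h1
          omega
        · omega)
    have := h.le k hkn
    simp at *
    omega
  refine ⟨a, ha, ⟨fun i j hi hj hij => ?_, fun i hi => ?_, fun i hi => ?_,
    fun i j k hij hjk hk h1 => ?_⟩, ⟨fun i j hi hj hij => ?_, fun i hi => ?_, fun i hi => ?_,
    fun i j k hij hjk hk h1 => ?_⟩, hmax⟩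
  · exact h.inj i j (by omega) (by omega) (by omega)
  · have := left i hi
    omega
  · have := hlt i (by omega) (by omega)
    omega
  · have := h.avoids i j k hij hjk (by omega) (by omega)
    omega
  · have := h.inj _ _ (by omega) (by omega) hij
    omega
  · exact h.pos _ (by omega)
  · have := right (a + 1 + i) (by omega) (by omega)
    omega
  · exact h.avoids _ _ _ (by omega) (by omega) (by omega) h1

theorem glue_injective {n a a' : ℕ} (ha : a ≤ n) (ha' : a' ≤ n) {f g f' g' : ℕ → ℤ}
    (hf : IsAvoidingPerm a f) (hg : IsAvoidingPerm (n - a) g)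
    (h : ∀ i, i < n + 1 → glue n a f g i = glue n a' f' g' i) :
    a = a' ∧ (∀ i, i < a → f i = f' i) ∧ ∀ i, i < n - a → g i = g' i := by
  have haa : a = a' := by
    refine (hf.glue ha hg).inj a a' (by omega) (by omega) ?_
    rw [h a' (by omega)]
    simp [glue]
  subst haa
  refine ⟨rfl, fun i hi => ?_, fun i hi => ?_⟩
  · simpa [glue, hi] using h i (by omega)
  · have := h (a + 1 + i) (by omega)
    simpa [glue, show ¬ a + 1 + i < a by omega, show a + 1 + i ≠ a by omega,
      show a + 1 + i - a - 1 = i by omega] using this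

/-- The generating polynomial of the number of ascents over permutations avoiding 1-3-2. -/
noncomputable def ascPolynomial (n : ℕ) : Polynomial ℤ :=
  ∑ w ∈ (avoidingPerms_finite n).toFinset, Polynomial.X ^ asc w

theorem coeff_ascPolynomial (n k : ℕ) : (ascPolynomial n).coeff k =
    (Nat.card {π : Fin n → ℤ // IsPermSeq n π ∧ Avoids132 π ∧ asc π = k} : ℤ) := by
  classical
  simp only [ascPolynomial, Polynomial.finsetSum_coeff, Polynomial.coeff_X_pow,
    Finset.sum_boole, Nat.cast_inj]
  rw [← Nat.card_eq_finsetCard]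
  refine Nat.card_congr (Equiv.subtypeEquivRight fun w => ?_)
  simp [avoidingPerms, and_assoc, eq_comm]

theorem ascPolynomial_succ (n : ℕ) : ascPolynomial (n + 1) =
    ∑ a ∈ Finset.range (n + 1),
      Polynomial.X ^ (if a = 0 then 0 else 1) * (ascPolynomial a * ascPolynomial (n - a)) := by
  simp only [ascPolynomial, Finset.sum_mul_sum]
  simp only [← Finset.sum_product', Finset.mul_sum]
  rw [Finset.sum_sigma']
  symm
  refine Finset.sum_bij
    (fun p _ => fun i : Fin (n + 1) => glue n p.1 (extendZero p.2.1) (extendZero p.2.2) i)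
    ?_ ?_ ?_ ?_
  · rintro ⟨a, σ, τ⟩ hp
    simp only [Finset.mem_sigma, Finset.mem_range, Finset.mem_product, Set.Finite.mem_toFinset,
      mem_avoidingPerms_iff] at hp
    rw [Set.Finite.mem_toFinset]
    exact restrict_mem_avoidingPerms (hp.2.1.glue (by omega) hp.2.2)
  · rintro ⟨a, σ, τ⟩ hp ⟨a', σ', τ'⟩ hp' heq
    simp only [Finset.mem_sigma, Finset.mem_range, Finset.mem_product, Set.Finite.mem_toFinset,
      mem_avoidingPerms_iff] at hp hp'
    obtain ⟨rfl, hσ, hτ⟩ := glue_injective (Nat.lt_succ_iff.1 hp.1) (Nat.lt_succ_iff.1 hp'.1)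
      hp.2.1 hp.2.2 (fun i hi => congrFun heq ⟨i, hi⟩)
    have h1 : σ = σ' := funext fun i => by simpa only [extendZero_val] using hσ i i.2
    have h2 : τ = τ' := funext fun i => by simpa only [extendZero_val] using hτ i i.2
    rw [h1, h2]
  · intro w hw
    rw [Set.Finite.mem_toFinset, mem_avoidingPerms_iff] at hw
    obtain ⟨a, ha, hl, hr, hmax⟩ := hw.exists_glue
    refine ⟨⟨a, fun i => extendZero w i - (n - a), fun i => extendZero w (a + 1 + i)⟩, ?_, ?_⟩
    · simp only [Finset.mem_sigma, Finset.mem_range, Finset.mem_product, Set.Finite.mem_toFinset]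
      exact ⟨by omega, restrict_mem_avoidingPerms hl, restrict_mem_avoidingPerms hr⟩
    · funext i
      have hi := i.2
      rw [← extendZero_val w i]
      simp only [glue]
      split_ifs with h1 h2
      · rw [extendZero_restrict (fun i => extendZero w i - (n - a)) h1]
        ring
      · rw [h2, hmax]
      · rw [extendZero_restrict (fun i => extendZero w (a + 1 + i)) (by omega)]
        congr 1
        omega
  · rintro ⟨a, σ, τ⟩ hp
    simp only [Finset.mem_sigma, Finset.mem_range, Finset.mem_product, Set.Finite.mem_toFinset,
      mem_avoidingPerms_iff] at hp
    rw [asc_eq_sum (w := σ) fun i => (extendZero_val σ i).symm,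
      asc_eq_sum (w := τ) fun i => (extendZero_val τ i).symm, asc_eq_sum fun i => rfl,
      Nat.add_sub_cancel, sum_ascents_glue (by omega) hp.2.1 hp.2.2, ← pow_add, ← pow_add]
    congr 1
    ring

theorem ascPolynomial_zero : ascPolynomial 0 = 1 := by
  have h : (avoidingPerms_finite 0).toFinset = {default} := by
    ext w
    simp [avoidingPerms, IsPermSeq, Avoids132, eq_iff_true_of_subsingleton,
      Function.injective_of_subsingleton]
  simp [ascPolynomial, h, asc]

/-- The polynomials `A_n(x) = Σ_{π ∈ S_n(1-3-2)} x^{asc(π)}`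
satisfy `A_{n+1}(x) = A_n(x) + x · Σ_{a+b=n, a≥1} A_a(x)·A_b(x)`. -/
theorem asc_polynomial_recurrence (A : ℕ → Polynomial ℤ)
    (hA : ∀ n k, (A n).coeff k =
      (Nat.card {π : Fin n → ℤ // IsPermSeq n π ∧ Avoids132 π ∧ asc π = k} : ℤ)) :
    ∀ n, A (n + 1) =
      A n + Polynomial.X * ∑ a ∈ Finset.Icc 1 n, A a * A (n - a) := by
  intro n
  obtain rfl : A = ascPolynomial :=
    funext fun n => Polynomial.ext fun k => (hA n k).trans (coeff_ascPolynomial n k).symm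
  rw [ascPolynomial_succ, Finset.sum_range_succ', Finset.mul_sum,
    add_comm, ← Finset.Ico_add_one_right_eq_Icc, Finset.sum_Ico_eq_sum_range]
  simp [ascPolynomial_zero, add_comm]
end

section
/- Let n ≥ 1, let π be a permutation of length n avoiding the pattern 1-3-2, let j be the position of the entry n, and let π' = (π_1,…,π_{j−1}) and π'' = (π_{j+1},…,π_n). Let s(w) = Σ_{k≥2} e_k(w) denote the total number of 2-increasing subsequences of a sequence w of distinct integers. Then s(π) = 2·s(π') + s(π'') + δ, where δ = 1 if π' is nonempty and δ = 0 if π' is empty. -/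
/-- The index set of a 2-increasing subsequence of `v`: the values increase along `S`, and the
successor of the least element of `S` belongs to `S`. -/
def IsTwoIncreasing (v : ℕ → ℤ) (S : Finset ℕ) : Prop :=
  StrictMonoOn v (S : Set ℕ) ∧ ∃ a ∈ S, a + 1 ∈ S ∧ ∀ c ∈ S, a ≤ c

open Classical in
/-- The 2-increasing index sets of `v` contained in the interval `[l, r)`. -/
noncomputable def twoIncreasingSets (v : ℕ → ℤ) (l r : ℕ) : Finset (Finset ℕ) :=
  (Finset.Ico l r).powerset.filter (IsTwoIncreasing v)

lemma mem_twoIncreasingSets {v : ℕ → ℤ} {l r : ℕ} {S : Finset ℕ} :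
    S ∈ twoIncreasingSets v l r ↔ (∀ c ∈ S, l ≤ c ∧ c < r) ∧ IsTwoIncreasing v S := by
  simp [twoIncreasingSets, Finset.subset_iff]

lemma Occ12.isTwoIncreasing_image {m k l : ℕ} {w : Fin m → ℤ} {v : ℕ → ℤ}
    (hv : ∀ a : Fin m, v (l + a) = w a) {i : Fin k → Fin m} (hk : 2 ≤ k) (hi : Occ12 k w i) :
    IsTwoIncreasing v (Finset.univ.image fun a => l + (i a : ℕ)) := by
  obtain ⟨hmono, hw, hadj⟩ := hi
  constructor
  · intro x hx y hy hxy
    simp only [Finset.coe_image, Finset.coe_univ, Set.image_univ, Set.mem_range] at hx hy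
    obtain ⟨a, rfl⟩ := hx
    obtain ⟨b, rfl⟩ := hy
    rw [hv, hv]
    apply hw
    rw [← hmono.lt_iff_lt, Fin.lt_def]
    omega
  · have h := hadj ⟨0, by omega⟩ ⟨1, by omega⟩ rfl rfl
    refine ⟨l + i ⟨0, by omega⟩, by simp, ?_, ?_⟩
    · rw [add_assoc, ← h]
      exact Finset.mem_image_of_mem _ (Finset.mem_univ _)
    · intro c hc
      obtain ⟨b, -, rfl⟩ := Finset.mem_image.1 hc
      have : i ⟨0, by omega⟩ ≤ i b := hmono.monotone (Fin.le_def.2 (Nat.zero_le _))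
      rw [Fin.le_def] at this
      omega

lemma exists_occ12_of_isTwoIncreasing {m l : ℕ} {w : Fin m → ℤ} {v : ℕ → ℤ}
    (hv : ∀ a : Fin m, v (l + a) = w a) {S : Finset ℕ} (hS : ∀ c ∈ S, l ≤ c ∧ c < l + m)
    (h : IsTwoIncreasing v S) :
    ∃ (k : ℕ) (i : Fin k → Fin m), 2 ≤ k ∧ Occ12 k w i ∧
      (Finset.univ.image fun a => l + (i a : ℕ)) = S := by
  obtain ⟨hmono, a, ha, ha', hmin⟩ := h
  have hcard : 2 ≤ S.card := Finset.one_lt_card.2 ⟨a, ha, a + 1, ha', by omega⟩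
  let e := S.orderEmbOfFin rfl
  have he : ∀ x, e x ∈ S := S.orderEmbOfFin_mem rfl
  have hsurj : ∀ y ∈ S, ∃ x, e x = y := by
    intro y hy
    have : y ∈ Set.range e := by rw [S.range_orderEmbOfFin rfl]; exact hy
    exact this
  have hadd : ∀ x, l + (e x - l) = e x := fun x => Nat.add_sub_cancel' (hS _ (he x)).1
  refine ⟨S.card, fun x => ⟨e x - l, by have := hS _ (he x); omega⟩, hcard, ⟨?_, ?_, ?_⟩, ?_⟩
  · intro x y hxy
    have h1 : e x < e y := e.strictMono hxy
    have h2 := hadd x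
    have h3 := hadd y
    rw [Fin.lt_def]
    dsimp only
    omega
  · intro x y hxy
    simp only [Function.comp_apply, ← hv, hadd]
    exact hmono (he x) (he y) (e.strictMono hxy)
  · intro x y hx hy
    obtain ⟨p, hp⟩ := hsurj a ha
    obtain ⟨q, hq⟩ := hsurj (a + 1) ha'
    have hxa : e x = a := by
      refine le_antisymm ?_ (hmin _ (he x))
      rw [← hp]
      exact e.monotone (Fin.le_def.2 (by omega))
    have hya : e y = a + 1 := by
      have h1 : e x < e y := e.strictMono (Fin.lt_def.2 (by omega))
      have h2 : e x < e q := by omega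
      have h3 : e y ≤ e q := by
        apply e.monotone
        have := Fin.lt_def.1 (e.lt_iff_lt.1 h2)
        exact Fin.le_def.2 (by omega)
      omega
    have := (hS a ha).1
    dsimp only
    omega
  · ext y
    simp only [Finset.mem_image, Finset.mem_univ, true_and, hadd]
    exact ⟨fun ⟨x, hx⟩ => hx ▸ he x, hsurj y⟩

lemma totE_eq_card_twoIncreasingSets {m : ℕ} (w : Fin m → ℤ) (v : ℕ → ℤ) (l r : ℕ)
    (hr : r = l + m) (hv : ∀ a : Fin m, v (l + a) = w a) :
    totE w = (twoIncreasingSets v l r).card := by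
  subst hr
  rw [totE, ← Nat.card_eq_finsetCard]
  refine Nat.card_eq_of_bijective
    (fun p => ⟨Finset.univ.image fun a => l + (p.2.1 a : ℕ), mem_twoIncreasingSets.2
      ⟨fun c hc => ?_, p.2.2.2.isTwoIncreasing_image hv p.2.2.1⟩⟩) ⟨?_, ?_⟩
  · obtain ⟨b, -, rfl⟩ := Finset.mem_image.1 hc
    omega
  · rintro ⟨k, i, hk, hi⟩ ⟨k', i', hk', hi'⟩ h
    have himage := congrArg Subtype.val h
    dsimp only at himage
    have hmono : StrictMono fun a => l + (i a : ℕ) := fun _ _ hab =>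
      Nat.add_lt_add_left (hi.1 hab) l
    have hmono' : StrictMono fun a => l + (i' a : ℕ) := fun _ _ hab =>
      Nat.add_lt_add_left (hi'.1 hab) l
    have hkk : k = k' := by
      have := congrArg Finset.card himage
      rwa [Finset.card_image_of_injective _ hmono.injective,
        Finset.card_image_of_injective _ hmono'.injective, Finset.card_fin,
        Finset.card_fin] at this
    subst hkk
    have hrange : (Set.range fun a => l + (i a : ℕ)) = Set.range fun a => l + (i' a : ℕ) := by
      simpa using congrArg (fun S : Finset ℕ => (S : Set ℕ)) himage
    have hfun := hmono.range_inj hmono' |>.1 hrange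
    have hii : i = i' := by
      funext a
      have := congrFun hfun a
      exact Fin.ext (Nat.add_left_cancel this)
    subst hii
    rfl
  · rintro ⟨S, hS⟩
    obtain ⟨hS, h⟩ := mem_twoIncreasingSets.1 hS
    obtain ⟨k, i, hk, hi, rfl⟩ := exists_occ12_of_isTwoIncreasing hv hS h
    exact ⟨⟨k, i, hk, hi⟩, rfl⟩

lemma IsTwoIncreasing.insert_top {v : ℕ → ℤ} {S : Finset ℕ} {j : ℕ}
    (h : IsTwoIncreasing v S) (hS : ∀ c ∈ S, c < j) (hv : ∀ c < j, v c < v j) :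
    IsTwoIncreasing v (insert j S) := by
  obtain ⟨hmono, a, ha, ha', hmin⟩ := h
  refine ⟨?_, a, by simp [ha], by simp [ha'], ?_⟩
  · intro x hx y hy hxy
    simp only [Finset.coe_insert, Set.mem_insert_iff, Finset.mem_coe] at hx hy
    rcases hx with rfl | hx <;> rcases hy with rfl | hy
    · omega
    · have := hS y hy
      omega
    · exact hv x (hS x hx)
    · exact hmono hx hy hxy
  · intro c hc
    rcases Finset.mem_insert.1 hc with rfl | hc
    · exact (hS a ha).le
    · exact hmin c hc

lemma isTwoIncreasing_pair {v : ℕ → ℤ} {a : ℕ} (h : v a < v (a + 1)) :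
    IsTwoIncreasing v {a, a + 1} := by
  refine ⟨?_, a, by simp, by simp, by simp⟩
  intro x hx y hy hxy
  simp only [Finset.coe_insert, Finset.coe_singleton, Set.mem_insert_iff,
    Set.mem_singleton_iff] at hx hy
  rcases hx with rfl | rfl <;> rcases hy with rfl | rfl <;> omega

lemma IsTwoIncreasing.erase_top {v : ℕ → ℤ} {S : Finset ℕ} {j : ℕ}
    (h : IsTwoIncreasing v S) (hj : j ∈ S) (hS : ∀ c ∈ S, c ≤ j) :
    IsTwoIncreasing v (S.erase j) ∨ (j ≠ 0 ∧ S = {j - 1, j}) := by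
  obtain ⟨hmono, a, ha, ha', hmin⟩ := h
  rcases (hS _ ha').lt_or_eq with hlt | rfl
  · refine Or.inl ⟨hmono.mono (by simp), a, ?_, ?_, fun c hc => hmin c (Finset.mem_of_mem_erase hc)⟩
    · exact Finset.mem_erase.2 ⟨by omega, ha⟩
    · exact Finset.mem_erase.2 ⟨by omega, ha'⟩
  · refine Or.inr ⟨by omega, ?_⟩
    ext c
    simp only [Nat.add_sub_cancel, Finset.mem_insert, Finset.mem_singleton]
    constructor
    · intro hc
      have := hS c hc
      have := hmin c hc
      omega
    · rintro (rfl | rfl) <;> assumption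

lemma IsTwoIncreasing.nonempty {v : ℕ → ℤ} {S : Finset ℕ} (h : IsTwoIncreasing v S) :
    S.Nonempty :=
  let ⟨_, a, ha, _⟩ := h
  ⟨a, ha⟩

lemma twoIncreasingSets_eq_union {v : ℕ → ℤ} {j n : ℕ} (hjn : j < n)
    (hleft : ∀ a < j, v a < v j) (hright : ∀ b, j < b → b < n → v b < v j)
    (hcross : ∀ a b, a < j → j < b → b < n → v b ≤ v a) :
    twoIncreasingSets v 0 n =
      (twoIncreasingSets v 0 j ∪ twoIncreasingSets v (j + 1) n) ∪
        ((twoIncreasingSets v 0 j).image (insert j) ∪ if j = 0 then ∅ else {{j - 1, j}}) := by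
  ext S
  simp only [Finset.mem_union, Finset.mem_image, mem_twoIncreasingSets]
  constructor
  · rintro ⟨hS, h⟩
    by_cases hj : j ∈ S
    · right
      have hle : ∀ c ∈ S, c ≤ j := by
        intro c hc
        by_contra! hlt
        exact absurd (h.1 hj hc hlt) (hright c hlt (hS c hc).2).not_gt
      rcases h.erase_top hj hle with h' | ⟨h0, rfl⟩
      · refine Or.inl ⟨S.erase j, ⟨fun c hc => ⟨c.zero_le, ?_⟩, h'⟩, Finset.insert_erase hj⟩
        exact lt_of_le_of_ne (hle c (Finset.mem_of_mem_erase hc)) (Finset.ne_of_mem_erase hc)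
      · simp [h0]
    · left
      by_cases hex : ∃ a ∈ S, a < j
      · obtain ⟨a, ha, haj⟩ := hex
        refine Or.inl ⟨fun c hc => ⟨c.zero_le, ?_⟩, h⟩
        by_contra! hle
        have hlt : j < c := lt_of_le_of_ne hle fun he => hj (he ▸ hc)
        exact absurd (h.1 ha hc (haj.trans hlt)) (hcross a c haj hlt (hS c hc).2).not_gt
      · push Not at hex
        refine Or.inr ⟨fun c hc => ⟨?_, (hS c hc).2⟩, h⟩
        exact lt_of_le_of_ne (hex c hc) fun he => hj (he ▸ hc)
  · rintro ((⟨hS, h⟩ | ⟨hS, h⟩) | (⟨T, ⟨hT, h⟩, rfl⟩ | h))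
    · exact ⟨fun c hc => ⟨c.zero_le, (hS c hc).2.trans hjn⟩, h⟩
    · exact ⟨fun c hc => ⟨c.zero_le, (hS c hc).2⟩, h⟩
    · refine ⟨fun c hc => ⟨c.zero_le, ?_⟩, h.insert_top (fun c hc => (hT c hc).2) hleft⟩
      rcases Finset.mem_insert.1 hc with rfl | hc
      · exact hjn
      · exact (hT c hc).2.trans hjn
    · split_ifs at h with h0
      · simp at h
      · obtain ⟨i, rfl⟩ := Nat.exists_eq_succ_of_ne_zero h0
        rw [Finset.mem_singleton] at h
        subst h
        refine ⟨fun c hc => ⟨c.zero_le, ?_⟩, isTwoIncreasing_pair (hleft i (by omega))⟩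
        simp only [Finset.mem_insert, Finset.mem_singleton] at hc
        omega

lemma card_twoIncreasingSets {v : ℕ → ℤ} {j n : ℕ} (hjn : j < n)
    (hleft : ∀ a < j, v a < v j) (hright : ∀ b, j < b → b < n → v b < v j)
    (hcross : ∀ a b, a < j → j < b → b < n → v b ≤ v a) :
    (twoIncreasingSets v 0 n).card =
      2 * (twoIncreasingSets v 0 j).card + (twoIncreasingSets v (j + 1) n).card +
        (if j = 0 then 0 else 1) := by
  have hnot : ∀ S ∈ twoIncreasingSets v 0 j, j ∉ S := fun S hS hj =>
    lt_irrefl j ((mem_twoIncreasingSets.1 hS).1 j hj).2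
  have hinj : Set.InjOn (insert j) (twoIncreasingSets v 0 j : Set (Finset ℕ)) := by
    intro S hS T hT hST
    rw [← Finset.erase_insert (hnot S hS), ← Finset.erase_insert (hnot T hT), hST]
  rw [twoIncreasingSets_eq_union hjn hleft hright hcross, Finset.card_union_of_disjoint,
    Finset.card_union_of_disjoint, Finset.card_union_of_disjoint, Finset.card_image_of_injOn hinj]
  · split_ifs <;> simp <;> omega
  · rw [Finset.disjoint_left]
    intro S hS h
    split_ifs at h with h0
    · simp at h
    · obtain ⟨T, hT, rfl⟩ := Finset.mem_image.1 hS
      rw [Finset.mem_singleton] at h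
      obtain ⟨hT', -, a, ha, ha', -⟩ := mem_twoIncreasingSets.1 hT
      have h1 : a ∈ insert j T := Finset.mem_insert_of_mem ha
      have h2 := (hT' _ ha').2
      rw [h] at h1
      simp only [Finset.mem_insert, Finset.mem_singleton] at h1
      omega
  · rw [Finset.disjoint_left]
    intro S hS hS'
    obtain ⟨h, h'⟩ := mem_twoIncreasingSets.1 hS
    obtain ⟨c, hc⟩ := h'.nonempty
    have := (h c hc).2
    have := ((mem_twoIncreasingSets.1 hS').1 c hc).1
    omega
  · rw [Finset.disjoint_left]
    intro S hS hS'
    have hjS : j ∈ S := by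
      rcases Finset.mem_union.1 hS' with h | h
      · obtain ⟨T, -, rfl⟩ := Finset.mem_image.1 h
        exact Finset.mem_insert_self j T
      · split_ifs at h with h0
        · simp at h
        · simp [Finset.mem_singleton.1 h]
    rcases Finset.mem_union.1 hS with h | h
    · exact hnot S h hjS
    · have := ((mem_twoIncreasingSets.1 h).1 j hjS).1
      omega

/-- If `π ∈ S_n(1-3-2)` has its maximal entry at position `j`,
and `s(w)` denotes the total number of 2-increasing subsequences of `w`,
then `s(π) = 2·s(π') + s(π'') + δ`, where `δ = 1` iff `π'` is nonempty. -/
theorem totE_decomposition (n : ℕ) (hn : 1 ≤ n) (π : Fin n → ℤ)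
    (hperm : IsPermSeq n π) (havoid : Avoids132 π)
    (j : Fin n) (hj : π j = (n : ℤ)) :
    totE π = 2 * totE (leftPart π j) + totE (rightPart π j) +
      (if (j : ℕ) = 0 then 0 else 1) := by
  let v : ℕ → ℤ := fun x => if h : x < n then π ⟨x, h⟩ else 0
  have hv : ∀ x (h : x < n), v x = π ⟨x, h⟩ := fun x h => dif_pos h
  have hvj : v j = π j := hv j j.isLt
  have hmax : ∀ x, x < n → x ≠ j → v x < v j := by
    intro x hx hxj
    rw [hv x hx, hvj]
    refine lt_of_le_of_ne (hj ▸ (hperm.2 _).2) fun h => hxj ?_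
    exact congrArg Fin.val (hperm.1 h)
  rw [totE_eq_card_twoIncreasingSets π v 0 n (by omega)
      (fun a => by rw [zero_add, hv a a.isLt]),
    totE_eq_card_twoIncreasingSets (leftPart π j) v 0 j (by omega)
      (fun a => by rw [zero_add, hv a (a.isLt.trans j.isLt)]; rfl),
    totE_eq_card_twoIncreasingSets (rightPart π j) v (j + 1) n (by omega)
      (fun a => by rw [hv (j + 1 + a) (by omega)]; rfl)]
  refine card_twoIncreasingSets j.isLt (fun a ha => hmax a (ha.trans j.isLt) ha.ne)
    (fun b hb hbn => hmax b hbn hb.ne') fun a b ha hb hbn => ?_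
  by_contra! h
  have hb' := hmax b hbn hb.ne'
  rw [hv b hbn] at h hb'
  rw [hv a (ha.trans j.isLt)] at h
  rw [hvj] at hb'
  exact havoid ⟨a, ha.trans j.isLt⟩ j ⟨b, hbn⟩ ha hb ⟨h, hb'⟩
end
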